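/- Define Φ(s) = (1/(2^{11/2}·θ̂^{1/2}·ζ_K(2)·s^{1/2})) ∫_{−θ̂^{−1/2}s^{1/2}}^{θ̂^{−1/2}s^{1/2}} ∫_{𝒲'} ∫_𝔉 1[𝓛h ∩ 𝒯(s) = ∅] dx₁ dx₂ dw dz₂, where ζ_K(2) = π⁴/(48√2). Then there exist a constant C > 0 and constants C' > 0, s₀ > 0 such that |Φ(s) − C·s^{−2}| ≤ C'·s^{−17/8} for all s ≥ s₀. -/

import Mathlib

open MeasureTheory Matrix Set Pointwise

noncomputable section

/-- The real embedding of `ℤ[√2]`, `a + b√2 ↦ a + b√2`. -/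
def emb (α : Zsqrtd 2) : ℝ := (α.re : ℝ) + (α.im : ℝ) * Real.sqrt 2

/-- The Galois-conjugate embedding `σ`, `a + b√2 ↦ a − b√2`. -/
def embc (α : Zsqrtd 2) : ℝ := (α.re : ℝ) - (α.im : ℝ) * Real.sqrt 2

/-- The fundamental unit `λ = 1 + √2`. -/
def lam : ℝ := 1 + Real.sqrt 2

/-- `𝓛'`: the Minkowski embedding of `ℤ[√2]` in `ℝ²`. -/
def Lp : Set (ℝ × ℝ) := {p | ∃ α : Zsqrtd 2, p = (emb α, embc α)}

/-- `v(β₁,β₂) = (β₁, β₂, σ(β₁), σ(β₂))`. -/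
def latvec (β₁ β₂ : Zsqrtd 2) : Fin 4 → ℝ := ![emb β₁, emb β₂, embc β₁, embc β₂]

/-- `𝓛`: the Minkowski embedding of `ℤ[√2]²` in `ℝ⁴`. -/
def Lquad : Set (Fin 4 → ℝ) := {v | ∃ β₁ β₂ : Zsqrtd 2, v = latvec β₁ β₂}

/-- `𝓛h`, for a 4×4 real matrix `h` (row vectors, right multiplication). -/
def latimage (h : Matrix (Fin 4) (Fin 4) ℝ) : Set (Fin 4 → ℝ) :=
  (fun v => Matrix.vecMul v h) '' Lquad

def nmat (x : ℝ) : Matrix (Fin 2) (Fin 2) ℝ := !![1, x; 0, 1]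
def amat (y : ℝ) : Matrix (Fin 2) (Fin 2) ℝ := !![y, 0; 0, y⁻¹]
def kmat (θ : ℝ) : Matrix (Fin 2) (Fin 2) ℝ :=
  !![Real.cos θ, -Real.sin θ; Real.sin θ, Real.cos θ]

/-- Block diagonal 4×4 matrix from two 2×2 blocks. -/
def bd (A B : Matrix (Fin 2) (Fin 2) ℝ) : Matrix (Fin 4) (Fin 4) ℝ :=
  !![A 0 0, A 0 1, 0, 0;
     A 1 0, A 1 1, 0, 0;
     0, 0, B 0 0, B 0 1;
     0, 0, B 1 0, B 1 1]

/-- `h(x₁,x₂,y₁,y₂,θ₁,θ₂) = diag(n(x₁)a(y₁)k(θ₁), n(x₂)a(y₂)k(θ₂))`. -/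
def hmat (x₁ x₂ y₁ y₂ θ₁ θ₂ : ℝ) : Matrix (Fin 4) (Fin 4) ℝ :=
  bd (nmat x₁ * amat y₁ * kmat θ₁) (nmat x₂ * amat y₂ * kmat θ₂)

/-- `H = SL₂(ℝ)² ⊂ SL₄(ℝ)` (block diagonal). -/
def Hset : Set (Matrix (Fin 4) (Fin 4) ℝ) :=
  {h | ∃ A B : Matrix (Fin 2) (Fin 2) ℝ, A.det = 1 ∧ B.det = 1 ∧ h = bd A B}

/-- `Γ_K = {diag(A, σ(A)) : A ∈ SL₂(ℤ[√2])}`. -/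
def GammaK : Set (Matrix (Fin 4) (Fin 4) ℝ) :=
  {g | ∃ A : Matrix (Fin 2) (Fin 2) (Zsqrtd 2), A.det = 1 ∧ g = bd (A.map emb) (A.map embc)}

/-- `𝒲`: the open regular octagon of side length √2. -/
def Woct : Set (ℝ × ℝ) :=
  {p | |p.1| < lam / Real.sqrt 2 ∧ |p.2| < lam / Real.sqrt 2 ∧ |p.1| + |p.2| < lam}

/-- `𝒲' = 𝒲 ∖ (√2−1)𝒲`. -/
def Wp : Set (ℝ × ℝ) := Woct \ ((Real.sqrt 2 - 1) • Woct)

/-- `θ̂ = 48√2/π⁴`, the density of visible points. -/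
def thetaHat : ℝ := 48 * Real.sqrt 2 / Real.pi ^ 4

/-- `T(s)`: open triangle with vertices `(0,0)`, `(s/θ̂)^{1/2}(1,±1)`. -/
def Tset (s : ℝ) : Set (ℝ × ℝ) :=
  {p | 0 < p.1 ∧ p.1 < Real.sqrt (s / thetaHat) ∧ |p.2| < p.1}

/-- `𝔉`: a fundamental domain of `𝓛'`. -/
def Fdom : Set (ℝ × ℝ) :=
  {p | ∃ r₁ ∈ Set.Ico (0:ℝ) 1, ∃ r₂ ∈ Set.Ico (0:ℝ) 1,
    p = (1 + r₁ + r₂ * Real.sqrt 2, 2 + r₁ - r₂ * Real.sqrt 2)}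

/-- The Siegel domain `𝔇_t`. -/
def Dset (t : ℝ) : Set (Matrix (Fin 4) (Fin 4) ℝ) :=
  {h | ∃ x₁ x₂ y₁ y₂ θ₁ θ₂ : ℝ, (x₁, x₂) ∈ Fdom ∧ 0 < y₁ ∧ 0 < y₂ ∧ t ≤ y₁ * y₂ ∧
    lam ^ (-2 : ℤ) ≤ y₁ / y₂ ∧ y₁ / y₂ ≤ lam ^ 2 ∧
    θ₁ ∈ Set.Ico 0 Real.pi ∧ θ₂ ∈ Set.Ico 0 Real.pi ∧ h = hmat x₁ x₂ y₁ y₂ θ₁ θ₂}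

/-- Row vector times 2×2 matrix, on `ℝ × ℝ`. -/
def mul2 (p : ℝ × ℝ) (M : Matrix (Fin 2) (Fin 2) ℝ) : ℝ × ℝ :=
  (p.1 * M 0 0 + p.2 * M 1 0, p.1 * M 0 1 + p.2 * M 1 1)

/-- `r(s)`: the unique integer with `λ^{2r} ≤ s^{1/4} < λ^{2(r+1)}`. -/
def rr (s : ℝ) : ℤ := ⌊Real.logb (lam ^ 2) (s ^ ((1:ℝ)/4))⌋

/-- `𝒯(s)` with explicit integer `r`: `λ^{−2r}T(s) × λ^{2r}𝒲`. -/
def calT (s : ℝ) (r : ℤ) : Set (Fin 4 → ℝ) :=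
  {v | (lam ^ (2*r) * v 0, lam ^ (2*r) * v 1) ∈ Tset s ∧
       (lam ^ (-(2*r)) * v 2, lam ^ (-(2*r)) * v 3) ∈ Woct}

/-- `𝒯(s) = λ^{−2r(s)}T(s) × λ^{2r(s)}𝒲`. -/
def calTs (s : ℝ) : Set (Fin 4 → ℝ) := calT s (rr s)

/-- Euclidean norm on `ℝ⁴`. -/
def enorm4 (v : Fin 4 → ℝ) : ℝ := Real.sqrt (∑ i, (v i) ^ 2)

/-- `𝓛h̃ = (ℤ(y₁,0,y₂,0) + ℤ√2(y₁,0,−y₂,0) + ℝ(0,1,0,0) + ℝ(0,0,0,1))·diag(k(θ₁),k(θ₂))`. -/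
def Ltilde (y₁ y₂ θ₁ θ₂ : ℝ) : Set (Fin 4 → ℝ) :=
  {v | ∃ (m n : ℤ) (c₁ c₂ : ℝ),
    v = Matrix.vecMul ![((m:ℝ) + (n:ℝ) * Real.sqrt 2) * y₁, c₁,
          ((m:ℝ) - (n:ℝ) * Real.sqrt 2) * y₂, c₂] (bd (kmat θ₁) (kmat θ₂))}

open Classical in
/-- Real-valued indicator of a proposition. -/
def ind (P : Prop) : ℝ := if P then 1 else 0

/-- `c_H = 3/π⁴`. -/
def cH : ℝ := 3 / Real.pi ^ 4

/-- `Y_t = {(y₁,y₂) : y₁,y₂ > 0, y₁y₂ ≥ t, y₁/y₂ ∈ (λ⁻²,λ²)}`. -/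
def Yt (t : ℝ) : Set (ℝ × ℝ) :=
  {y | 0 < y.1 ∧ 0 < y.2 ∧ t ≤ y.1 * y.2 ∧ lam ^ (-2:ℤ) < y.1 / y.2 ∧ y.1 / y.2 < lam ^ 2}

/-- The main term `G_M(s)` (depending on the Siegel-domain parameter `t`). -/
def GM (t s : ℝ) : ℝ :=
  cH * ∫ θ₂ in Set.Ico (0:ℝ) Real.pi, ∫ θ₁ in Set.Ico (0:ℝ) Real.pi, ∫ y in Yt t, ∫ x in Fdom,
    (y.1 ^ 3 * y.2 ^ 3)⁻¹ * ind (Ltilde y.1 y.2 θ₁ θ₂ ∩ calTs s = ∅)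

/-- The error term `G_E(s)`. -/
def GE (t s : ℝ) : ℝ :=
  cH * ∫ θ₂ in Set.Ico (0:ℝ) Real.pi, ∫ θ₁ in Set.Ico (0:ℝ) Real.pi, ∫ y in Yt t, ∫ x in Fdom,
    (y.1 ^ 3 * y.2 ^ 3)⁻¹ *
      ind (latimage (hmat x.1 x.2 y.1 y.2 θ₁ θ₂) ∩ calTs s = ∅ ∧
           (Ltilde y.1 y.2 θ₁ θ₂ ∩ calTs s).Nonempty)

/-- `J = [0,π/4] ∪ [3π/4,π)`. -/
def Jset : Set ℝ := Set.Icc 0 (Real.pi/4) ∪ Set.Ico (3*Real.pi/4) Real.pi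

/-- `Y = {(y₁,y₂) : y₁ > 0, 1 < y₂ < λ²}`. -/
def Yset : Set (ℝ × ℝ) := {y | 0 < y.1 ∧ 1 < y.2 ∧ y.2 < lam ^ 2}

/-- `T₁`: open triangle with vertices `(0,0)`, `(1,±1)`. -/
def T1 : Set (ℝ × ℝ) := {p | 0 < p.1 ∧ p.1 < 1 ∧ |p.2| < p.1}

/-- `ℓ₁(θ₁)`: first-coordinate projection of `θ̂^{−1/2}T₁k(−θ₁)`. -/
def ell1 (θ₁ : ℝ) : Set ℝ :=
  {x | ∃ p ∈ T1, x = (mul2 ((Real.sqrt thetaHat)⁻¹ • p) (kmat (-θ₁))).1}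

/-- `ℓ₂(θ₂)`: first-coordinate projection of `𝒲k(−θ₂)`. -/
def ell2 (θ₂ : ℝ) : Set ℝ := {x | ∃ p ∈ Woct, x = (mul2 p (kmat (-θ₂))).1}

/-- `C_𝒫 = 2304(2−√2)/π⁸`. -/
def CP : ℝ := 2304 * (2 - Real.sqrt 2) / Real.pi ^ 8

/-- `ζ_K(2) = π⁴/(48√2)`. -/
def zetaK2 : ℝ := Real.pi ^ 4 / (48 * Real.sqrt 2)

/-- `𝒯'(s) = T(s) × 𝒲`. -/
def Tprime (s : ℝ) : Set (Fin 4 → ℝ) :=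
  {v | (v 0, v 1) ∈ Tset s ∧ (v 2, v 3) ∈ Woct}

/-- `L₁(θ₁)` from Lemma 3.4: projection of `λ^{−2r}T(s)k(−θ₁)` onto the x-axis. -/
def L1set (s : ℝ) (r : ℤ) (θ₁ : ℝ) : Set ℝ :=
  {x | ∃ p ∈ Tset s, x = (mul2 ((lam ^ (-(2*r)) : ℝ) • p) (kmat (-θ₁))).1}

/-- `L₂(θ₂)`: projection of `λ^{2r}𝒲k(−θ₂)` onto the x-axis. -/
def L2set (r : ℤ) (θ₂ : ℝ) : Set ℝ :=
  {x | ∃ p ∈ Woct, x = (mul2 ((lam ^ (2*r) : ℝ) • p) (kmat (-θ₂))).1}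

/-- `n(x)a(y)k(θ)` where `y,θ` are determined by `y⁻¹(sin θ, cos θ) = z`. -/
def hz (z : ℝ × ℝ) (x : ℝ) : Matrix (Fin 2) (Fin 2) ℝ :=
  nmat x * amat (Real.sqrt (z.1 ^ 2 + z.2 ^ 2))⁻¹ *
    !![(Real.sqrt (z.1 ^ 2 + z.2 ^ 2))⁻¹ * z.2, -((Real.sqrt (z.1 ^ 2 + z.2 ^ 2))⁻¹ * z.1);
       (Real.sqrt (z.1 ^ 2 + z.2 ^ 2))⁻¹ * z.1, (Real.sqrt (z.1 ^ 2 + z.2 ^ 2))⁻¹ * z.2]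

/-- The function `F₂` of Lemma 4.7. -/
def F2 (z₁ : ℝ) : ℝ :=
  (24 / Real.pi ^ 4) * ∫ z₂ in Set.Ioo (-z₁) z₁, ∫ w in Wp, ∫ x in Fdom,
    ind (latimage (bd (hz (z₁, z₂) x.1) (hz w x.2)) ∩ Tprime (z₁ ^ 2 * thetaHat) = ∅)

/-- The box `B(α₃,α₄)`. -/
def Bbox (α₃ α₄ : Zsqrtd 2) (C₁ s : ℝ) : Set (ℝ × ℝ) :=
  {x | |x.1 + emb α₄ / emb α₃| ≤ C₁ / Real.sqrt s ∧
       |x.2 + embc α₄ / embc α₃| ≤ C₁ / Real.sqrt s}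

/-- The matrix `h` determined by `s, z₂, w, x₁, x₂` via
`y₁⁻¹(sin θ₁, cos θ₁) = λ^{−2r}(θ̂^{−1/2}s^{1/2}, z₂)`, `y₂⁻¹(sin θ₂, cos θ₂) = λ^{2r}w`. -/
def hfull (s z₂ : ℝ) (w : ℝ × ℝ) (x₁ x₂ : ℝ) : Matrix (Fin 4) (Fin 4) ℝ :=
  bd (hz ((lam ^ (-(2 * rr s)) : ℝ) • (Real.sqrt (s / thetaHat), z₂)) x₁)
     (hz ((lam ^ (2 * rr s) : ℝ) • w) x₂)

/-- `F⁺_{(α₃,α₄)}(s)`. -/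
def Fplus (α₃ α₄ : Zsqrtd 2) (C₁ s : ℝ) : ℝ :=
  (Real.sqrt s)⁻¹ * ∫ z₂ in Set.Ioo (0:ℝ) (Real.sqrt (s / thetaHat)), ∫ w in Wp,
    ∫ x in Bbox α₃ α₄ C₁ s, ind (latimage (hfull s z₂ w x.1 x.2) ∩ calTs s = ∅)

/-- `F⁻_{(α₃,α₄)}(s)`. -/
def Fminus (α₃ α₄ : Zsqrtd 2) (C₁ s : ℝ) : ℝ :=
  (Real.sqrt s)⁻¹ * ∫ z₂ in Set.Ioo (-Real.sqrt (s / thetaHat)) (0:ℝ), ∫ w in Wp,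
    ∫ x in Bbox α₃ α₄ C₁ s, ind (latimage (hfull s z₂ w x.1 x.2) ∩ calTs s = ∅)

/-- `F_{(α₃,α₄)}(s)`. -/
def Ffull (α₃ α₄ : Zsqrtd 2) (C₁ s : ℝ) : ℝ :=
  (Real.sqrt s)⁻¹ *
    ∫ z₂ in Set.Ioo (-Real.sqrt (s / thetaHat)) (Real.sqrt (s / thetaHat)), ∫ w in Wp,
      ∫ x in Bbox α₃ α₄ C₁ s, ind (latimage (hfull s z₂ w x.1 x.2) ∩ calTs s = ∅)

/-- `v₁ = (α₃, α₄, σ(α₃), σ(α₄))`. -/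
def vv1 (α₃ α₄ : Zsqrtd 2) : Fin 4 → ℝ := ![emb α₃, emb α₄, embc α₃, embc α₄]

/-- `v₂ = (√2α₃, √2α₄, −√2σ(α₃), −√2σ(α₄))`. -/
def vv2 (α₃ α₄ : Zsqrtd 2) : Fin 4 → ℝ :=
  ![Real.sqrt 2 * emb α₃, Real.sqrt 2 * emb α₄,
    -(Real.sqrt 2 * embc α₃), -(Real.sqrt 2 * embc α₄)]

/-- `b₁ = (α₃, α₄, 0, 0)`. -/
def bb1 (α₃ α₄ : Zsqrtd 2) : Fin 4 → ℝ := ![emb α₃, emb α₄, 0, 0]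

/-- `b₂ = (0, 0, σ(α₃), σ(α₄))`. -/
def bb2 (α₃ α₄ : Zsqrtd 2) : Fin 4 → ℝ := ![0, 0, embc α₃, embc α₄]

/-- The subgrid `𝓛_v = v + ℤv₁ + ℤv₂`. -/
def Lv (α₃ α₄ : Zsqrtd 2) (v : Fin 4 → ℝ) : Set (Fin 4 → ℝ) :=
  {u | ∃ m n : ℤ, u = v + (m:ℝ) • vv1 α₃ α₄ + (n:ℝ) • vv2 α₃ α₄}

/-- The filled plane `Π_v = v + ℝb₁ + ℝb₂`. -/
def Piv (α₃ α₄ : Zsqrtd 2) (v : Fin 4 → ℝ) : Set (Fin 4 → ℝ) :=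
  {u | ∃ c₁ c₂ : ℝ, u = v + c₁ • bb1 α₃ α₄ + c₂ • bb2 α₃ α₄}

/-- `d(s) = θ̂^{−1/2}λ^{−2r}s^{1/2}`. -/
def ds (s : ℝ) : ℝ := lam ^ (-(2 * rr s)) * Real.sqrt (s / thetaHat)

/-- The explicit integral representation `Φ(s)` of the limiting gap distribution `F(s)`. -/
def Phi (s : ℝ) : ℝ :=
  (1 / ((2:ℝ) ^ ((11:ℝ)/2) * Real.sqrt thetaHat * zetaK2 * Real.sqrt s)) *
    ∫ z₂ in Set.Ioo (-Real.sqrt (s / thetaHat)) (Real.sqrt (s / thetaHat)), ∫ w in Wp,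
      ∫ x in Fdom, ind (latimage (hfull s z₂ w x.1 x.2) ∩ calTs s = ∅)

section ZsqrtdTwo

theorem sqrt_two_bounds : (1.414 : ℝ) < √2 ∧ √2 < 1.415 ∧ √2 * √2 = 2 := by
  refine ⟨?_, ?_, Real.mul_self_sqrt (by norm_num)⟩
  · apply Real.lt_sqrt_of_sq_lt; norm_num
  · rw [Real.sqrt_lt' (by norm_num)]; norm_num

theorem emb_zero : emb 0 = 0 := by simp [emb]
theorem embc_zero : embc 0 = 0 := by simp [embc]
theorem emb_one : emb 1 = 1 := by simp [emb]
theorem embc_one : embc 1 = 1 := by simp [embc]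

theorem emb_add (a b : Zsqrtd 2) : emb (a + b) = emb a + emb b := by simp [emb]; ring
theorem embc_add (a b : Zsqrtd 2) : embc (a + b) = embc a + embc b := by simp [embc]; ring
theorem emb_neg (a : Zsqrtd 2) : emb (-a) = -emb a := by simp [emb]; ring
theorem embc_neg (a : Zsqrtd 2) : embc (-a) = -embc a := by simp [embc]; ring
theorem emb_sub (a b : Zsqrtd 2) : emb (a - b) = emb a - emb b := by simp [emb]; ring
theorem embc_sub (a b : Zsqrtd 2) : embc (a - b) = embc a - embc b := by simp [embc]; ring

theorem emb_mul (a b : Zsqrtd 2) : emb (a * b) = emb a * emb b := by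
  simp only [emb, Zsqrtd.re_mul, Zsqrtd.im_mul]; push_cast
  linear_combination -((a.im : ℝ) * b.im) * sqrt_two_bounds.2.2

theorem embc_mul (a b : Zsqrtd 2) : embc (a * b) = embc a * embc b := by
  simp only [embc, Zsqrtd.re_mul, Zsqrtd.im_mul]; push_cast
  linear_combination -((a.im : ℝ) * b.im) * sqrt_two_bounds.2.2

theorem emb_mul_embc (a : Zsqrtd 2) : emb a * embc a = (a.norm : ℝ) := by
  simp only [emb, embc, Zsqrtd.norm_def]; push_cast
  linear_combination -((a.im : ℝ) * a.im) * sqrt_two_bounds.2.2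

theorem norm_ne_zero_of_ne {a : Zsqrtd 2} (ha : a ≠ 0) : a.norm ≠ 0 := by
  refine fun h => ha ((Zsqrtd.norm_eq_zero (fun n hn => ?_) a).1 h)
  have h1 : n < 2 := by nlinarith
  have h2 : -2 < n := by nlinarith
  interval_cases n <;> omega

theorem one_le_abs_norm {a : Zsqrtd 2} (ha : a ≠ 0) : (1 : ℝ) ≤ |emb a| * |embc a| := by
  rw [← abs_mul, emb_mul_embc, ← Int.cast_abs]
  exact_mod_cast Int.one_le_abs (norm_ne_zero_of_ne ha)

theorem emb_ne_zero {a : Zsqrtd 2} (ha : a ≠ 0) : emb a ≠ 0 := by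
  intro h; have := one_le_abs_norm ha; rw [h] at this; norm_num at this

theorem embc_ne_zero {a : Zsqrtd 2} (ha : a ≠ 0) : embc a ≠ 0 := by
  intro h; have := one_le_abs_norm ha; rw [h] at this; norm_num at this

theorem emb_pow (a : Zsqrtd 2) (n : ℕ) : emb (a ^ n) = emb a ^ n := by
  induction n with
  | zero => simp [emb_one]
  | succ n ih => rw [pow_succ, emb_mul, ih, pow_succ]

theorem embc_pow (a : Zsqrtd 2) (n : ℕ) : embc (a ^ n) = embc a ^ n := by
  induction n with
  | zero => simp [embc_one]
  | succ n ih => rw [pow_succ, embc_mul, ih, pow_succ]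

theorem lam_sq : lam ^ 2 = 3 + 2 * √2 := by
  unfold lam; linear_combination sqrt_two_bounds.2.2

theorem lam_pos : 0 < lam := by unfold lam; positivity

/-- Even powers of `λ` are units of norm one, given together with their inverses. -/
theorem exists_unit_zpow (n : ℤ) : ∃ u v : Zsqrtd 2, u * v = 1 ∧ emb u = lam ^ (2 * n) ∧
    embc u = (lam ^ (2 * n))⁻¹ ∧ emb v = (lam ^ (2 * n))⁻¹ ∧ embc v = lam ^ (2 * n) := by
  have h1 : emb ⟨3, 2⟩ = lam ^ 2 := by rw [lam_sq]; simp [emb]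
  have h2 : embc ⟨3, -2⟩ = lam ^ 2 := by rw [lam_sq]; simp [embc]
  have hinv : (lam ^ 2)⁻¹ = 3 - 2 * √2 := by
    rw [lam_sq]; refine inv_eq_of_mul_eq_one_right ?_
    linear_combination (-4) * sqrt_two_bounds.2.2
  have h3 : emb ⟨3, -2⟩ = (lam ^ 2)⁻¹ := by rw [hinv]; simp [emb]; ring
  have h4 : embc ⟨3, 2⟩ = (lam ^ 2)⁻¹ := by rw [hinv]; simp [embc]
  have h5 : (⟨3, 2⟩ * ⟨3, -2⟩ : Zsqrtd 2) = 1 := by ext <;> simp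
  have h6 : (⟨3, -2⟩ * ⟨3, 2⟩ : Zsqrtd 2) = 1 := by ext <;> simp
  rcases n.eq_nat_or_neg with ⟨k, rfl | rfl⟩
  · refine ⟨⟨3, 2⟩ ^ k, ⟨3, -2⟩ ^ k, by rw [← mul_pow, h5, one_pow], ?_⟩
    rw [emb_pow, embc_pow, emb_pow, embc_pow, h1, h2, h3, h4, _root_.zpow_mul]
    simp [zpow_natCast]
  · refine ⟨⟨3, -2⟩ ^ k, ⟨3, 2⟩ ^ k, by rw [← mul_pow, h6, one_pow], ?_⟩
    rw [emb_pow, embc_pow, emb_pow, embc_pow, h1, h2, h3, h4, _root_.zpow_mul]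
    simp [zpow_natCast]

theorem exists_unit_approx {r : ℝ} (hr : 0 < r) : ∃ u v : Zsqrtd 2, u * v = 1 ∧ r ≤ emb u ∧
    emb u < 6 * r ∧ embc u = (emb u)⁻¹ ∧ emb v = (emb u)⁻¹ ∧ embc v = emb u := by
  have h1 : (1 : ℝ) < lam ^ 2 := by rw [lam_sq]; linarith [sqrt_two_bounds.1]
  obtain ⟨n, hn1, hn2⟩ := exists_mem_Ioc_zpow hr h1
  obtain ⟨u, v, huv, e1, e2, e3, e4⟩ := exists_unit_zpow (n + 1)
  have e5 : lam ^ (2 * (n + 1)) = (lam ^ 2) ^ (n + 1) := by rw [_root_.zpow_mul]; norm_cast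
  refine ⟨u, v, huv, by rw [e1, e5]; exact hn2, ?_, by rw [e1, e2], by rw [e1, e3],
    by rw [e1, e4]⟩
  rw [e1, e5, zpow_add_one₀ (by positivity)]
  have : (0 : ℝ) < (lam ^ 2) ^ n := by have := lam_pos; positivity
  have h6 : lam ^ 2 < 6 := by rw [lam_sq]; linarith [sqrt_two_bounds.2.1]
  nlinarith

/-- Every rectangle of large area meets the Minkowski embedding of `ℤ[√2]`. -/
theorem exists_mem_rect {l l' : ℝ} (hl : 0 < l) (h : 14 ≤ l * l') (a b : ℝ) :
    ∃ m : Zsqrtd 2, |emb m - a| < l ∧ |embc m - b| < l' := by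
  obtain ⟨s1, s2, s3⟩ := sqrt_two_bounds
  have base : ∀ a b : ℝ, ∃ m : Zsqrtd 2, |emb m - a| < 3 / 2 ∧ |embc m - b| < 3 / 2 := by
    intro a b
    refine ⟨⟨round ((a + b) / 2), round ((a - b) * √2 / 4)⟩, ?_⟩
    have h1 := abs_le.1 (abs_sub_round ((a + b) / 2))
    have h2 := abs_le.1 (abs_sub_round ((a - b) * √2 / 4))
    set R := ((round ((a + b) / 2) : ℤ) : ℝ)
    set Q := ((round ((a - b) * √2 / 4) : ℤ) : ℝ)
    have e : (a - b) * √2 / 4 * √2 = (a - b) / 2 := by linear_combination (a - b) / 4 * s3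
    have q1 : Q * √2 ≤ (a - b) / 2 + √2 / 2 := by nlinarith
    have q2 : (a - b) / 2 - √2 / 2 ≤ Q * √2 := by nlinarith
    simp only [emb, embc, abs_lt]
    refine ⟨⟨?_, ?_⟩, ⟨?_, ?_⟩⟩ <;> linarith
  obtain ⟨u, v, huv, u1, u2, u3, u4, u5⟩ :=
    exists_unit_approx (r := 3 / 2 / l) (by positivity)
  have hu : 0 < emb u := lt_of_lt_of_le (by positivity) u1
  obtain ⟨m, m1, m2⟩ := base (emb u * a) (embc u * b)
  have k1 : 3 / 2 ≤ emb u * l := by rwa [div_le_iff₀ hl] at u1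
  have k2 : emb u * l < 9 := by
    have := mul_lt_mul_of_pos_right u2 hl
    rwa [show 6 * (3 / 2 / l) * l = 9 by field_simp; norm_num] at this
  refine ⟨v * m, ?_, ?_⟩
  · have : emb u * |emb (v * m) - a| < emb u * l := by
      rw [← abs_of_pos hu, ← abs_mul, abs_of_pos hu, emb_mul, u4,
        show emb u * ((emb u)⁻¹ * emb m - a) = emb m - emb u * a by field_simp]
      linarith
    exact lt_of_mul_lt_mul_left this hu.le
  · rw [embc_mul, u5, show emb u * embc m - b = emb u * (embc m - embc u * b) by
      rw [u3]; field_simp, abs_mul, abs_of_pos hu]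
    have h3 : emb u * (3 / 2) < l' := lt_of_mul_lt_mul_right (a := l) (by linarith) hl.le
    exact (mul_lt_mul_of_pos_left m2 hu).trans h3

theorem exists_mem_affine_rect {c c' l l' : ℝ} (hc : c ≠ 0) (hc' : c' ≠ 0) (hl : 0 < l)
    (h : 14 * |c * c'| ≤ l * l') (a b : ℝ) :
    ∃ m : Zsqrtd 2, |c * emb m - a| < l ∧ |c' * embc m - b| < l' := by
  have k := abs_pos.2 hc
  have k' := abs_pos.2 hc'
  obtain ⟨m, h1, h2⟩ := exists_mem_rect (l := l / |c|) (l' := l' / |c'|) (by positivity)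
    (by rw [abs_mul] at h; field_simp; linarith) (a / c) (b / c')
  refine ⟨m, ?_, ?_⟩
  · rw [lt_div_iff₀ k, ← abs_mul] at h1
    rwa [show (emb m - a / c) * c = c * emb m - a by field_simp] at h1
  · rw [lt_div_iff₀ k', ← abs_mul] at h2
    rwa [show (embc m - b / c') * c' = c' * embc m - b by field_simp] at h2

/-- Dirichlet approximation over `ℤ[√2]`. -/
theorem exists_dirichlet (y₁ y₂ : ℝ) {K : ℕ} (hK : 0 < K) : ∃ m n : Zsqrtd 2, m ≠ 0 ∧
    |emb m| ≤ 3 * K ∧ |embc m| ≤ 3 * K ∧ |emb m * y₁ + emb n| ≤ 3 / K ∧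
    |embc m * y₂ + embc n| ≤ 3 / K := by
  obtain ⟨s1, s2, s3⟩ := sqrt_two_bounds
  have hK' : (0 : ℝ) < K := by exact_mod_cast hK
  let z : ℕ × ℕ → Zsqrtd 2 := fun i => ⟨i.1, i.2⟩
  let f : ℕ × ℕ → ℝ := fun i => (emb (z i) * y₁ + embc (z i) * y₂) / 2
  let g : ℕ × ℕ → ℝ := fun i => (emb (z i) * y₁ - embc (z i) * y₂) * √2 / 4
  let c : ℕ × ℕ → ℕ × ℕ := fun i => (⌊K * Int.fract (f i)⌋₊, ⌊K * Int.fract (g i)⌋₊)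
  have hc : ∀ x : ℝ, ⌊K * Int.fract x⌋₊ < K := fun x => by
    rw [Nat.floor_lt (mul_nonneg hK'.le (Int.fract_nonneg x))]
    nlinarith [Int.fract_lt_one x]
  obtain ⟨i, hi, j, hj, hij, hcij⟩ := Finset.exists_ne_map_eq_of_card_lt_of_maps_to
    (s := Finset.range (K + 1) ×ˢ Finset.range (K + 1))
    (t := Finset.range K ×ˢ Finset.range K) (f := c)
    (by simp only [Finset.card_product, Finset.card_range]; nlinarith)
    (fun i _ => by simp only [Finset.coe_product, Set.mem_prod, Finset.coe_range, Set.mem_Iio]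
                   exact ⟨hc _, hc _⟩)
  simp only [Finset.mem_product, Finset.mem_range, Nat.lt_succ_iff] at hi hj
  have key : ∀ x y : ℝ, ⌊K * Int.fract x⌋₊ = ⌊K * Int.fract y⌋₊ →
      |x - y - (⌊x⌋ - ⌊y⌋ : ℤ)| ≤ 1 / K := fun x y h => by
    have a1 := Nat.floor_le (mul_nonneg hK'.le (Int.fract_nonneg x))
    have a2 := Nat.lt_floor_add_one (K * Int.fract x)
    have b1 := Nat.floor_le (mul_nonneg hK'.le (Int.fract_nonneg y))
    have b2 := Nat.lt_floor_add_one (K * Int.fract y)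
    rw [h] at a1 a2
    push_cast
    rw [show x - y - ((⌊x⌋ : ℝ) - ⌊y⌋) = Int.fract x - Int.fract y by
      unfold Int.fract; ring, le_div_iff₀ hK', ← abs_of_pos hK', ← abs_mul, abs_le]
    constructor <;> nlinarith
  have k1 := key _ _ (congrArg Prod.fst hcij)
  have k2 := key _ _ (congrArg Prod.snd hcij)
  set p : ℤ := ⌊f i⌋ - ⌊f j⌋
  set q : ℤ := ⌊g i⌋ - ⌊g j⌋
  have d1 : |((i.1 : ℝ) - j.1)| ≤ K := by
    have e1 : (i.1 : ℝ) ≤ K := by exact_mod_cast hi.1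
    have e2 : (j.1 : ℝ) ≤ K := by exact_mod_cast hj.1
    rw [abs_le]; constructor <;> linarith [(Nat.cast_nonneg i.1 : (0 : ℝ) ≤ i.1),
      (Nat.cast_nonneg j.1 : (0 : ℝ) ≤ j.1)]
  have d2 : |((i.2 : ℝ) - j.2)| ≤ K := by
    have e1 : (i.2 : ℝ) ≤ K := by exact_mod_cast hi.2
    have e2 : (j.2 : ℝ) ≤ K := by exact_mod_cast hj.2
    rw [abs_le]; constructor <;> linarith [(Nat.cast_nonneg i.2 : (0 : ℝ) ≤ i.2),
      (Nat.cast_nonneg j.2 : (0 : ℝ) ≤ j.2)]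
  have d3 : |((i.2 : ℝ) - j.2) * √2| ≤ 1.415 * K := by
    rw [abs_mul, abs_of_pos (by linarith : 0 < √2)]
    nlinarith [abs_nonneg ((i.2 : ℝ) - j.2)]
  have k3 : |(g i - g j - q) * √2| ≤ 1.415 / K := by
    rw [abs_mul, abs_of_pos (by linarith : 0 < √2), div_eq_mul_one_div]
    nlinarith [abs_nonneg (g i - g j - q)]
  have g2 : ∀ i, g i * √2 = (emb (z i) * y₁ - embc (z i) * y₂) / 2 := fun i => by
    simp only [g]; linear_combination (emb (z i) * y₁ - embc (z i) * y₂) / 4 * s3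
  have h3 : (3 : ℝ) / K = 1 / K + 1.415 / K + 0.585 / K := by ring
  have h4 : (0 : ℝ) < 0.585 / K := by positivity
  rw [abs_le] at d1 d3 k1 k3
  refine ⟨z i - z j, -⟨p, q⟩, ?_, ?_, ?_, ?_, ?_⟩
  · refine fun h => hij ?_
    have h0 := sub_eq_zero.1 h
    simp only [z, Zsqrtd.ext_iff] at h0
    exact Prod.ext (by exact_mod_cast h0.1) (by exact_mod_cast h0.2)
  · simp only [z, emb, Zsqrtd.re_sub, Zsqrtd.im_sub, Int.cast_sub, Int.cast_natCast, abs_le]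
    constructor <;> linarith
  · simp only [z, embc, Zsqrtd.re_sub, Zsqrtd.im_sub, Int.cast_sub, Int.cast_natCast, abs_le]
    constructor <;> linarith
  · rw [show emb (z i - z j) * y₁ + emb (-⟨p, q⟩) = (f i - f j - p) + (g i - g j - q) * √2 by
      rw [sub_mul, sub_mul, g2, g2, emb_sub, emb_neg]; simp only [f, emb]; ring, abs_le, h3]
    constructor <;> linarith
  · rw [show embc (z i - z j) * y₂ + embc (-⟨p, q⟩) = (f i - f j - p) - (g i - g j - q) * √2 by
      rw [sub_mul, sub_mul, g2, g2, embc_sub, embc_neg]; simp only [f, embc]; ring, abs_le, h3]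
    constructor <;> linarith

/-- Bézout's identity in `ℤ[√2]`, from the Euclidean algorithm. -/
theorem exists_bezout (a b : Zsqrtd 2) (hab : a ≠ 0 ∨ b ≠ 0) :
    ∃ g a' b' x y : Zsqrtd 2, a = g * a' ∧ b = g * b' ∧ a' * x + b' * y = 1 := by
  induction h : b.norm.natAbs using Nat.strong_induction_on generalizing a b with
  | _ k ih =>
    rcases eq_or_ne b 0 with rfl | hb
    · exact ⟨a, 1, 0, 1, 0, by simp⟩
    obtain ⟨q, hq⟩ : ∃ q, (a - b * q).norm.natAbs < b.norm.natAbs := by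
      have hB := norm_ne_zero_of_ne hb
      let c : Zsqrtd 2 := a * star b
      have hB' : (b.norm : ℝ) ≠ 0 := by exact_mod_cast hB
      let q : Zsqrtd 2 := ⟨round ((c.re : ℝ) / b.norm), round ((c.im : ℝ) / b.norm)⟩
      refine ⟨q, ?_⟩
      have e0 : (a - b * q).norm * b.norm = (c - b.norm * q).norm := by
        rw [← Zsqrtd.norm_conj b, ← Zsqrtd.norm_mul, Zsqrtd.norm_conj, Zsqrtd.norm_eq_mul_conj b]
        congr 1; simp only [c]; ring
      have r1 := abs_le.1 (abs_sub_round ((c.re : ℝ) / b.norm))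
      have r2 := abs_le.1 (abs_sub_round ((c.im : ℝ) / b.norm))
      have e1 : ((c - b.norm * q).norm : ℝ) = (b.norm : ℝ) ^ 2 *
          (((c.re : ℝ) / b.norm - q.re) ^ 2 - 2 * ((c.im : ℝ) / b.norm - q.im) ^ 2) := by
        rw [Zsqrtd.norm_def]
        simp only [Zsqrtd.re_sub, Zsqrtd.im_sub, Zsqrtd.re_smul, Zsqrtd.im_smul]
        push_cast; field_simp
      have e2 : ((a - b * q).norm : ℝ) = b.norm *
          (((c.re : ℝ) / b.norm - q.re) ^ 2 - 2 * ((c.im : ℝ) / b.norm - q.im) ^ 2) := by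
        have := congrArg (Int.cast (R := ℝ)) e0
        rw [e1] at this; push_cast at this
        exact mul_right_cancel₀ hB' (by rw [this]; ring)
      have e3 : |((c.re : ℝ) / b.norm - q.re) ^ 2 - 2 * ((c.im : ℝ) / b.norm - q.im) ^ 2| < 1 := by
        rw [abs_lt]; constructor <;> simp only [q] <;> nlinarith
      rw [← Int.ofNat_lt, Int.natCast_natAbs, Int.natCast_natAbs, ← Int.cast_lt (R := ℝ),
        Int.cast_abs, Int.cast_abs, e2, abs_mul]
      exact mul_lt_of_lt_one_right (abs_pos.2 hB') e3
    obtain ⟨g, b', r', x, y, h1, h2, h3⟩ := ih _ (h ▸ hq) b (a - b * q) (Or.inl hb) rfl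
    exact ⟨g, b' * q + r', b', y, x - q * y, by linear_combination h2 + q * h1, h1,
      by linear_combination h3⟩

end ZsqrtdTwo

section Octagon

theorem mem_Woct_iff {p : ℝ × ℝ} : p ∈ Woct ↔
    |p.1| * √2 < lam ∧ |p.2| * √2 < lam ∧ |p.1| + |p.2| < lam := by
  have : 0 < √2 := by linarith [sqrt_two_bounds.1]
  simp only [Woct, mem_ofPred_eq, lt_div_iff₀ this]

theorem mem_Woct_of_le_one {p : ℝ × ℝ} (h1 : |p.1| ≤ 1) (h2 : |p.2| ≤ 1) : p ∈ Woct := by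
  obtain ⟨s1, s2, s3⟩ := sqrt_two_bounds
  rw [mem_Woct_iff, lam]
  refine ⟨?_, ?_, ?_⟩ <;> nlinarith

theorem abs_lt_of_mem_Woct {p : ℝ × ℝ} (h : p ∈ Woct) : |p.1| < 2 ∧ |p.2| < 2 := by
  obtain ⟨s1, s2, s3⟩ := sqrt_two_bounds
  rw [mem_Woct_iff, lam] at h
  constructor <;> nlinarith

theorem neg_mem_Woct {p : ℝ × ℝ} (h : p ∈ Woct) : -p ∈ Woct := by
  simpa [mem_Woct_iff] using h

theorem convex_Woct : Convex ℝ Woct := by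
  have h : Woct = {p : ℝ × ℝ | |p.1| < lam / √2} ∩ {p | |p.2| < lam / √2} ∩
      {p | |p.1| + |p.2| < lam} := by ext; simp [Woct, and_assoc]
  have a1 : ConvexOn ℝ univ (fun p : ℝ × ℝ => |p.1|) :=
    (convexOn_norm (E := ℝ) convex_univ).comp_linearMap (LinearMap.fst ℝ ℝ ℝ)
  have a2 : ConvexOn ℝ univ (fun p : ℝ × ℝ => |p.2|) :=
    (convexOn_norm (E := ℝ) convex_univ).comp_linearMap (LinearMap.snd ℝ ℝ ℝ)
  rw [h]
  have c1 := a1.convex_lt (lam / √2)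
  have c2 := a2.convex_lt (lam / √2)
  have c3 := (a1.add a2).convex_lt lam
  simp only [mem_univ, true_and, Pi.add_apply] at c1 c2 c3
  exact (c1.inter c2).inter c3

theorem isOpen_Woct : IsOpen Woct := by
  have h : Woct = {p : ℝ × ℝ | |p.1| < lam / √2} ∩ {p | |p.2| < lam / √2} ∩
      {p | |p.1| + |p.2| < lam} := by ext; simp [Woct, and_assoc]
  rw [h]
  exact ((isOpen_lt (by fun_prop) (by fun_prop)).inter
    (isOpen_lt (by fun_prop) (by fun_prop))).inter (isOpen_lt (by fun_prop) (by fun_prop))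

theorem zero_mem_Woct : (0 : ℝ × ℝ) ∈ Woct := mem_Woct_of_le_one (by simp) (by simp)

theorem smul_mem_Woct {p : ℝ × ℝ} (h : p ∈ Woct) {c : ℝ} (hc : |c| ≤ 1) : c • p ∈ Woct := by
  rw [mem_Woct_iff] at h ⊢
  simp only [Prod.smul_fst, Prod.smul_snd, smul_eq_mul, abs_mul]
  have := abs_nonneg c; have := abs_nonneg p.1; have := abs_nonneg p.2
  have := sqrt_two_bounds.1
  have h0 : ∀ A : ℝ, 0 ≤ A → A < lam → |c| * A < lam := fun A hA h =>
    (mul_le_of_le_one_left hA hc).trans_lt h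
  refine ⟨?_, ?_, ?_⟩
  · rw [mul_assoc]; exact h0 _ (by positivity) h.1
  · rw [mul_assoc]; exact h0 _ (by positivity) h.2.1
  · rw [← mul_add]; exact h0 _ (by positivity) h.2.2

theorem smul_add_mem_Woct {p q : ℝ × ℝ} (h : p ∈ Woct) {c r : ℝ} (hc : |c| ≤ 1 - r)
    (h1 : |q.1| ≤ r) (h2 : |q.2| ≤ r) : c • p + q ∈ Woct := by
  have hr : 0 ≤ r := (abs_nonneg _).trans h1
  rcases hr.eq_or_lt with rfl | hr
  · have : q = 0 := Prod.ext (abs_nonpos_iff.1 h1) (abs_nonpos_iff.1 h2)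
    rw [this, add_zero]; exact smul_mem_Woct h (by linarith)
  have hr1 : r ≤ 1 := by linarith [abs_nonneg c]
  have hq : r⁻¹ • q ∈ Woct := by
    apply mem_Woct_of_le_one <;>
      simp only [Prod.smul_fst, Prod.smul_snd, smul_eq_mul, abs_mul, abs_inv, abs_of_pos hr] <;>
      rw [inv_mul_le_iff₀ hr] <;> linarith
  rcases hr1.eq_or_lt with rfl | hr1
  · have : c = 0 := abs_nonpos_iff.1 (by linarith)
    rw [this, zero_smul, zero_add]; simpa using hq
  have hp : (c / (1 - r)) • p ∈ Woct := smul_mem_Woct h (by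
    rw [abs_div, abs_of_pos (by linarith : 0 < 1 - r), div_le_one (by linarith)]; exact hc)
  have := convex_Woct hp hq (by linarith : 0 ≤ 1 - r) hr.le (by ring)
  rwa [smul_smul, smul_smul, mul_div_cancel₀ _ (by linarith : 1 - r ≠ 0),
    mul_inv_cancel₀ hr.ne', one_smul] at this

theorem mem_Wp_iff {w : ℝ × ℝ} : w ∈ Wp ↔ w ∈ Woct ∧ lam • w ∉ Woct := by
  have s := sqrt_two_bounds
  have h : (√2 - 1)⁻¹ = lam := by
    rw [inv_eq_of_mul_eq_one_right]; unfold lam; linear_combination s.2.2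
  rw [Wp, mem_sdiff, Set.mem_smul_set_iff_inv_smul_mem₀ (by linarith), h]

theorem half_le_of_mem_Wp {w : ℝ × ℝ} (h : w ∈ Wp) : 1 / 2 ≤ w.1 ^ 2 + w.2 ^ 2 := by
  have h2 := (mem_Wp_iff.1 h).2
  by_contra! h0
  have s := sqrt_two_bounds
  have hl : lam * (√2 - 1) = 1 := by unfold lam; linear_combination s.2.2
  have hl0 := lam_pos
  refine h2 (mem_Woct_iff.2 ?_)
  simp only [Prod.smul_fst, Prod.smul_snd, smul_eq_mul, abs_mul, abs_of_pos hl0, mul_assoc,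
    ← mul_add]
  have e1 := sq_abs w.1
  have e2 := sq_abs w.2
  have key : ∀ A : ℝ, A < 1 → lam * A < lam := fun A hA => by nlinarith
  refine ⟨key _ ?_, key _ ?_, key _ ?_⟩
  · refine abs_lt_of_sq_lt_sq' (a := |w.1| * √2) (b := 1) (by nlinarith) (by norm_num) |>.2
  · refine abs_lt_of_sq_lt_sq' (a := |w.2| * √2) (b := 1) (by nlinarith) (by norm_num) |>.2
  · refine abs_lt_of_sq_lt_sq' (a := |w.1| + |w.2|) (b := 1)
      (by nlinarith [sq_nonneg (|w.1| - |w.2|)]) (by norm_num) |>.2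

/-- The vector `p` with `w ∧ p` fixed by the sign `e`, up to the shear `x`. -/
def pvec (e : ℝ) (w : ℝ × ℝ) (x : ℝ) : ℝ × ℝ :=
  (e / (w.1 ^ 2 + w.2 ^ 2)) • ((w.2, -w.1) : ℝ × ℝ) + x • w

theorem abs_pvec_zero_le {e : ℝ} (he : |e| = 1) {w : ℝ × ℝ} (h : w ∈ Wp) :
    |(pvec e w 0).1| ≤ 2 ∧ |(pvec e w 0).2| ≤ 2 := by
  have h1 := half_le_of_mem_Wp h
  have key : ∀ a : ℝ, a ^ 2 ≤ w.1 ^ 2 + w.2 ^ 2 → 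
      1 / (w.1 ^ 2 + w.2 ^ 2) * |a| ≤ 2 := fun a ha => by
    rw [div_mul_eq_mul_div, one_mul, div_le_iff₀ (by linarith)]
    nlinarith [sq_abs a, sq_nonneg (|a| - 1)]
  simp only [pvec, zero_smul, add_zero, Prod.smul_mk, smul_eq_mul, abs_mul, abs_div, he, abs_neg]
  rw [abs_of_pos (by linarith : 0 < w.1 ^ 2 + w.2 ^ 2)]
  exact ⟨key _ (by nlinarith [sq_nonneg w.1]), key _ (by nlinarith [sq_nonneg w.2])⟩

theorem pvec_eq (e : ℝ) (w : ℝ × ℝ) (x : ℝ) : pvec e w x = pvec e w 0 + x • w := by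
  simp [pvec]

theorem neg_pvec (e : ℝ) (w : ℝ × ℝ) (x : ℝ) : -pvec e w x = pvec (-e) w (-x) := by
  simp [pvec, neg_div]; ring_nf

end Octagon

section Avoidance

/-- No lattice point lies in the rescaled product of the triangle and the octagon. -/
def Av (ε t x : ℝ) (w p : ℝ × ℝ) : Prop :=
  ∀ m n : Zsqrtd 2, ¬(0 < emb m * x + emb n ∧ emb m * x + emb n < 1 ∧
    |t * (emb m * x + emb n) - ε * emb m| < emb m * x + emb n ∧
    embc m • p + embc n • w ∈ Woct)

theorem exists_short {ε : ℝ} (h0 : 0 < ε) (h1 : ε < 1) (x₁ x₂ : ℝ) :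
    ∃ a b : Zsqrtd 2, a ≠ 0 ∧ |ε * emb a| ≤ 36 * √ε ∧ |emb a * x₁ + emb b| ≤ 3 * √ε ∧
      |embc a| ≤ 6 ∧ |embc a * x₂ + embc b| ≤ 18 := by
  set R := √ε
  have hR : 0 < R := Real.sqrt_pos.2 h0
  have hR2 : R * R = ε := Real.mul_self_sqrt h0.le
  set Q := √R
  have hQ : 0 < Q := Real.sqrt_pos.2 hR
  have hQ2 : Q * Q = R := Real.mul_self_sqrt hR.le
  have hQ1 : Q ≤ 1 := Real.sqrt_le_one.2 (Real.sqrt_le_one.2 h1.le)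
  have hL : 1 ≤ Q⁻¹ := (one_le_inv₀ hQ).2 hQ1
  set L := Q⁻¹
  have hLQ : L * Q = 1 := inv_mul_cancel₀ hQ.ne'
  have hLR : L * L * R = 1 := by rw [← hQ2]; linear_combination (L * Q + 1) * hLQ
  obtain ⟨u, v, huv, u1, u2, u3, u4, u5⟩ := exists_unit_approx (r := L) (by linarith)
  set K := ⌈L⌉₊
  have hK1 : L ≤ K := Nat.le_ceil L
  have hK2 : (K : ℝ) < L + 1 := Nat.ceil_lt_add_one (by linarith)
  have hu : 0 < emb u := by linarith
  have hK0 : (0 : ℝ) < K := by linarith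
  obtain ⟨m, n, hm, m1, m2, m3, m4⟩ := exists_dirichlet (emb u ^ 2 * x₁) ((emb u)⁻¹ ^ 2 * x₂)
    (K := K) (by exact_mod_cast hK0)
  have hmu : m * u ≠ 0 := by
    intro h; apply hm
    calc m = m * (u * v) := by rw [huv, mul_one]
      _ = (m * u) * v := by ring
      _ = 0 := by rw [h, zero_mul]
  have i1 : (emb u)⁻¹ ≤ Q := by
    rw [inv_le_comm₀ hu hQ]; exact u1
  have i2 : 3 / (K : ℝ) ≤ 3 * Q := by
    rw [div_le_iff₀ hK0]; nlinarith
  have i0 : 0 < (emb u)⁻¹ := by positivity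
  have A1 : |ε * emb (m * u)| ≤ 36 * R := by
    rw [emb_mul, abs_mul, abs_mul, abs_of_pos h0, abs_of_pos hu]
    have : |emb m| * emb u ≤ (6 * L) * (6 * L) := by gcongr; linarith
    calc ε * (|emb m| * emb u) ≤ ε * ((6 * L) * (6 * L)) := by gcongr
      _ = 36 * R := by rw [← hR2]; linear_combination 36 * R * hLR
  have A2 : |emb (m * u) * x₁ + emb (n * v)| ≤ 3 * R := by
    rw [emb_mul, emb_mul, u4, show emb m * emb u * x₁ + emb n * (emb u)⁻¹ =
      (emb u)⁻¹ * (emb m * (emb u ^ 2 * x₁) + emb n) by field_simp, abs_mul, abs_of_pos i0]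
    calc _ ≤ Q * (3 * Q) := by gcongr; linarith
      _ = 3 * R := by rw [← hQ2]; ring
  have A3 : |embc (m * u)| ≤ 6 := by
    rw [embc_mul, u3, abs_mul, abs_of_pos i0]
    calc _ ≤ (6 * L) * Q := by gcongr; linarith
      _ = 6 := by rw [mul_assoc, hLQ, mul_one]
  have A4 : |embc (m * u) * x₂ + embc (n * v)| ≤ 18 := by
    rw [embc_mul, embc_mul, u3, u5, show embc m * (emb u)⁻¹ * x₂ + embc n * emb u =
      emb u * (embc m * ((emb u)⁻¹ ^ 2 * x₂) + embc n) by field_simp, abs_mul, abs_of_pos hu]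
    calc _ ≤ (6 * L) * (3 * Q) := by gcongr; linarith
      _ = 18 := by linear_combination 18 * hLQ
  exact ⟨m * u, n * v, hmu, A1, A2, A3, A4⟩

theorem exists_short_primitive {ε : ℝ} (h0 : 0 < ε) (h1 : ε < 1) (x₁ x₂ : ℝ) :
    ∃ a b c d : Zsqrtd 2, a ≠ 0 ∧ a * d - b * c = 1 ∧ |ε * emb a| ≤ 36 * √ε ∧
      |emb a * x₁ + emb b| ≤ 36 * √ε ∧ |embc a| ≤ 108 ∧ |embc a * x₂ + embc b| ≤ 108 := by
  obtain ⟨α, β, hα, A1, A2, A3, A4⟩ := exists_short h0 h1 x₁ x₂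
  have hR := Real.sqrt_nonneg ε
  obtain ⟨g, a, b, x, y, hga, hgb, hxy⟩ := exists_bezout α β (Or.inl hα)
  have hg : g ≠ 0 := by
    rintro rfl; rw [zero_mul] at hga; exact hα hga
  have hg' := abs_pos.2 (emb_ne_zero hg)
  obtain ⟨U, V, hUV, U1, U2, U3, U4, U5⟩ := exists_unit_approx (r := |emb g|⁻¹) (by positivity)
  have hU : 0 < emb U := lt_of_lt_of_le (by positivity) U1
  have B1 : 1 ≤ |emb (g * U)| := by
    rw [emb_mul, abs_mul, abs_of_pos hU]
    calc 1 = |emb g| * |emb g|⁻¹ := by field_simp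
      _ ≤ _ := by gcongr
  have B2 : 1 ≤ 6 * |embc (g * U)| := by
    rw [embc_mul, abs_mul, U3, abs_of_pos (inv_pos.2 hU), ← div_eq_mul_inv, ← mul_div_assoc,
      le_div_iff₀ hU]
    have := one_le_abs_norm hg
    calc 1 * emb U ≤ 6 * |emb g|⁻¹ * 1 := by linarith
      _ ≤ 6 * |emb g|⁻¹ * (|emb g| * |embc g|) := by gcongr
      _ = _ := by field_simp
  have e1 : α = (g * U) * (a * V) := by
    rw [hga]; linear_combination -(g * a) * hUV
  have e2 : β = (g * U) * (b * V) := by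
    rw [hgb]; linear_combination -(g * b) * hUV
  have key : ∀ x y B : ℝ, 1 ≤ |x| → |x * y| ≤ B → |y| ≤ B := fun x y B h1 h2 => by
    rw [abs_mul] at h2; nlinarith [abs_nonneg y]
  have key' : ∀ x y B : ℝ, 1 ≤ 6 * |x| → |x * y| ≤ B → |y| ≤ 6 * B := fun x y B h1 h2 => by
    rw [abs_mul] at h2; nlinarith [abs_nonneg y]
  refine ⟨a * V, b * V, -(y * U), x * U, ?_, ?_, ?_, ?_, ?_, ?_⟩
  · intro h; rw [h, mul_zero] at e1; exact hα e1
  · linear_combination hxy + (a * x + b * y) * hUV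
  · refine key _ _ _ B1 ?_
    rwa [mul_left_comm, ← emb_mul, ← e1]
  · refine (key (emb (g * U)) _ (3 * √ε) B1 ?_).trans (by linarith)
    rw [mul_add, ← mul_assoc, ← emb_mul, ← emb_mul, ← e1, ← e2]; exact A2
  · refine (key' (embc (g * U)) _ 6 B2 ?_).trans (by norm_num)
    rwa [← embc_mul, ← e1]
  · refine (key' (embc (g * U)) _ 18 B2 ?_).trans (by norm_num)
    rw [mul_add, ← mul_assoc, ← embc_mul, ← embc_mul, ← e1, ← e2]; exact A4

end Avoidance

section UnimodularCoordinates

/-- `Av` in the coordinates of a primitive pair `(a, b)` completed to a basis. -/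
theorem Av.basis {ε t x₁ x₂ : ℝ} {w p : ℝ × ℝ} (h : Av ε t x₁ w (p + x₂ • w))
    {a b c d : Zsqrtd 2} (ha : a ≠ 0) (hd : a * d - b * c = 1) {γ γ' : ℝ}
    (hγ : emb a * x₁ + emb b = γ * (ε * emb a)) (hγ' : embc a * x₂ + embc b = γ' * embc a)
    (k μ : Zsqrtd 2) {κ κ' z z' : ℝ} (hκ : κ * emb a = emb k) (hκ' : κ' * embc a = embc k)
    (hz : z = ε * emb a * (emb μ + κ * emb c)) (hz' : z' = embc a * (embc μ + κ' * embc c)) :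
    ¬(0 < κ + γ * z ∧ κ + γ * z < 1 ∧ |t * (κ + γ * z) - z| < κ + γ * z ∧
      (κ' + γ' * z') • w + z' • p ∈ Woct) := by
  have e1 := congrArg emb hd
  have e2 := congrArg embc hd
  rw [emb_sub, emb_mul, emb_mul, emb_one] at e1
  rw [embc_sub, embc_mul, embc_mul, embc_one] at e2
  have a1 := emb_ne_zero ha
  have a2 := embc_ne_zero ha
  have f1 : emb (k * c + μ * a) * x₁ + emb (k * d + μ * b) = κ + γ * z := by
    simp only [emb_add, emb_mul, ← hκ, hz]
    linear_combination κ * e1 + (emb μ + κ * emb c) * hγ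
  have f2 : ε * emb (k * c + μ * a) = z := by
    simp only [emb_add, emb_mul, ← hκ, hz]; ring
  have f3 : embc (k * c + μ * a) • (p + x₂ • w) + embc (k * d + μ * b) • w =
      (κ' + γ' * z') • w + z' • p := by
    have : embc (k * c + μ * a) * x₂ + embc (k * d + μ * b) = κ' + γ' * z' := by
      simp only [embc_add, embc_mul, ← hκ', hz']
      linear_combination κ' * e2 + (embc μ + κ' * embc c) * hγ'
    rw [← this, smul_add, smul_smul, add_smul, hz', embc_add, embc_mul, embc_mul, ← hκ']
    module
  have := h (k * c + μ * a) (k * d + μ * b)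
  rwa [f1, f2, f3] at this

/-- A shear of a small box contains a box with the expected proportions. -/
theorem exists_shear_center {γ d c : ℝ} (hd : |d| ≤ c * (1 + |γ|)) :
    ∃ ν : ℝ, ∀ ζ, |ζ| ≤ c / (1 + |γ|) → |d + γ * (ν + ζ)| ≤ 3 * c ∧ |ν + ζ| ≤ 3 * c := by
  have hγ := abs_nonneg γ
  have hc : 0 ≤ c := by
    by_contra! h
    nlinarith [abs_nonneg d]
  have hs : |γ| * |γ| = γ ^ 2 := by rw [← sq, sq_abs]
  have hp : 0 < 1 + γ ^ 2 := by positivity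
  refine ⟨-(d * γ / (1 + γ ^ 2)), fun ζ hζ => ?_⟩
  have z1 : |γ * ζ| ≤ c := by
    rw [abs_mul]
    rw [le_div_iff₀ (by positivity)] at hζ
    nlinarith [abs_nonneg ζ]
  have z2 : |ζ| ≤ c := by
    rw [le_div_iff₀ (by positivity)] at hζ
    nlinarith [abs_nonneg ζ]
  have d1 : |d / (1 + γ ^ 2)| ≤ 2 * c := by
    rw [abs_div, abs_of_pos hp, div_le_iff₀ hp]
    nlinarith [sq_nonneg (|γ| - 1)]
  have d2 : |d * γ / (1 + γ ^ 2)| ≤ 2 * c := by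
    rw [abs_div, abs_of_pos hp, div_le_iff₀ hp, abs_mul]
    nlinarith [sq_nonneg (|γ| - 1), mul_le_mul_of_nonneg_right hd hγ]
  constructor
  · rw [show d + γ * (-(d * γ / (1 + γ ^ 2)) + ζ) = d / (1 + γ ^ 2) + γ * ζ by field_simp; ring]
    linarith [abs_add_le (d / (1 + γ ^ 2)) (γ * ζ)]
  · have := abs_add_le (-(d * γ / (1 + γ ^ 2))) ζ
    rw [abs_neg] at this; linarith

theorem exists_small_multiplier {δ δ' A l l' : ℝ} (hδ : δ ≠ 0) (hδ' : δ' ≠ 0) (hl : 0 < l)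
    (h : 14 * |δ * δ'| ≤ l * l') (B : ℝ) (y y' : ℝ) :
    ∃ m : Zsqrtd 2, |δ * (emb m + A) - y| < l ∧ |δ' * (embc m + B) - y'| < l' := by
  obtain ⟨m, m1, m2⟩ := exists_mem_affine_rect hδ hδ' hl h (y - δ * A) (y' - δ' * B)
  refine ⟨m, ?_, ?_⟩
  · rwa [mul_add, show δ * emb m + δ * A - y = δ * emb m - (y - δ * A) by ring]
  · rwa [mul_add, show δ' * embc m + δ' * B - y' = δ' * embc m - (y' - δ' * B) by ring]

theorem abs_combo_le {w p : ℝ × ℝ} (hw : |w.1| ≤ 2 ∧ |w.2| ≤ 2) (hp : |p.1| ≤ 2 ∧ |p.2| ≤ 2)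
    {r s B B' : ℝ} (hr : |r| ≤ B) (hs : |s| ≤ B') :
    |(r • w + s • p).1| ≤ 2 * B + 2 * B' ∧ |(r • w + s • p).2| ≤ 2 * B + 2 * B' := by
  have key : ∀ x y : ℝ, |x| ≤ 2 → |y| ≤ 2 → |r * x + s * y| ≤ 2 * B + 2 * B' := fun x y hx hy => by
    have h1 : |r| * |x| ≤ B * 2 := by gcongr; exact (abs_nonneg r).trans hr
    have h2 : |s| * |y| ≤ B' * 2 := by gcongr; exact (abs_nonneg s).trans hs
    calc _ ≤ |r * x| + |s * y| := abs_add_le _ _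
      _ ≤ _ := by rw [abs_mul, abs_mul]; linarith
  exact ⟨key _ _ hw.1 hp.1, key _ _ hw.2 hp.2⟩

theorem Av.norm_mul_lt {ε t x₁ x₂ : ℝ} {w p : ℝ × ℝ} (h : Av ε t x₁ w (p + x₂ • w))
    (hε : 0 < ε) (hε' : √ε ≤ 1 / 10 ^ 12) (ht : |t| ≤ 1) (hw : |w.1| ≤ 2 ∧ |w.2| ≤ 2)
    (hp : |p.1| ≤ 2 ∧ |p.2| ≤ 2)
    {a b c d : Zsqrtd 2} (ha : a ≠ 0) (hd : a * d - b * c = 1) {γ γ' : ℝ}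
    (hγ : emb a * x₁ + emb b = γ * (ε * emb a)) (hγ' : embc a * x₂ + embc b = γ' * embc a)
    (a1 : |ε * emb a| ≤ 36 * √ε) (a2 : |emb a * x₁ + emb b| ≤ 36 * √ε)
    (a3 : |embc a| ≤ 108) (a4 : |embc a * x₂ + embc b| ≤ 108) :
    |emb a * embc a| * ((1 + |γ|) * (1 + |γ'|)) < 12600 := by
  have b1 := emb_ne_zero ha
  have b2 := embc_ne_zero ha
  by_contra! H
  have g1 := abs_nonneg γ
  have g2 := abs_nonneg γ'
  have N0 : 0 < |emb a * embc a| := abs_pos.2 (mul_ne_zero b1 b2)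
  obtain ⟨k, k1, k2⟩ := exists_small_multiplier (δ := (emb a)⁻¹) (δ' := (embc a)⁻¹)
    (l := 1 / 30 * (1 + |γ|)) (l' := 1 / 30 * (1 + |γ'|)) (A := 0) (inv_ne_zero b1)
    (inv_ne_zero b2) (by positivity) (by
      rw [← mul_inv, abs_inv, ← div_eq_mul_inv, div_le_iff₀ N0]; linarith) 0
    (1 / 2 - γ * (t / 2)) 0
  simp only [add_zero, sub_zero] at k1 k2
  set κ := (emb a)⁻¹ * emb k with hκ
  set κ' := (embc a)⁻¹ * embc k with hκ'
  obtain ⟨ν, hν⟩ := exists_shear_center k1.le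
  obtain ⟨ν', hν'⟩ := exists_shear_center k2.le
  have S : |(ε * emb a) * embc a| * ((1 + |γ|) * (1 + |γ'|)) ≤ 1 / 12600 := by
    rw [hγ, abs_mul] at a2
    rw [hγ', abs_mul] at a4
    rw [abs_mul]
    calc |ε * emb a| * |embc a| * ((1 + |γ|) * (1 + |γ'|)) =
        (|ε * emb a| + |γ| * |ε * emb a|) * (|embc a| + |γ'| * |embc a|) := by ring
      _ ≤ (36 * √ε + 36 * √ε) * (108 + 108) := by gcongr
      _ ≤ 1 / 12600 := by linarith
  obtain ⟨μ, m1, m2⟩ := exists_small_multiplier (δ := ε * emb a) (δ' := embc a)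
    (l := 1 / 30 / (1 + |γ|)) (l' := 1 / 30 / (1 + |γ'|)) (A := κ * emb c)
    (mul_ne_zero hε.ne' b1) b2 (by positivity) (by
      rw [div_mul_div_comm, le_div_iff₀ (by positivity)]; linarith) (κ' * embc c)
    (t / 2 + ν) ν'
  set z := ε * emb a * (emb μ + κ * emb c)
  set z' := embc a * (embc μ + κ' * embc c)
  have H1 := hν _ m1.le
  have H2 := hν' _ m2.le
  rw [show κ - (1 / 2 - γ * (t / 2)) + γ * (ν + (z - (t / 2 + ν))) = κ + γ * z - 1 / 2 by ring,
    show ν + (z - (t / 2 + ν)) = z - t / 2 by ring] at H1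
  rw [add_sub_cancel] at H2
  refine h.basis ha hd hγ hγ' k μ (κ := κ) (κ' := κ') (z := z) (z' := z')
    (by rw [hκ]; field_simp) (by rw [hκ']; field_simp) rfl rfl ?_
  set X := κ + γ * z
  have H3 : |t * (X - 1 / 2)| ≤ 1 / 10 := by
    rw [abs_mul]
    exact (mul_le_mul ht H1.1 (abs_nonneg _) zero_le_one).trans (by norm_num)
  obtain ⟨P1, P2⟩ := H1
  have Q := abs_combo_le hw hp H2.1 H2.2
  rw [abs_le] at P1 P2 H3
  refine ⟨by linarith, by linarith, ?_, mem_Woct_of_le_one (by linarith) (by linarith)⟩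
  rw [abs_lt]; constructor <;> linarith

end UnimodularCoordinates

section LatticeWindow

/-- Powers of `λ` are, up to sign, units of `ℤ[√2]`. -/
theorem exists_lam_zpow (n : ℤ) : ∃ u : Zsqrtd 2, u ≠ 0 ∧ emb u = lam ^ n ∧
    |embc u| = (lam ^ n)⁻¹ := by
  have hl := lam_pos
  have s := sqrt_two_bounds
  have key : ∀ {u v : Zsqrtd 2}, u * v = 1 → u ≠ 0 := by
    rintro u v h rfl; simp at h
  rcases Int.even_or_odd' n with ⟨j, rfl | rfl⟩
  · obtain ⟨u, v, h, h1, h2, -⟩ := exists_unit_zpow j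
    exact ⟨u, key h, h1, by rw [h2, abs_of_pos (by positivity)]⟩
  · obtain ⟨u, v, h, h1, h2, -⟩ := exists_unit_zpow j
    have e1 : emb ⟨1, 1⟩ = lam := by simp [emb, lam]
    have e2 : |embc ⟨1, 1⟩| = lam⁻¹ := by
      have : embc ⟨1, 1⟩ = 1 - √2 := by simp [embc]
      rw [this, abs_of_neg (by linarith), eq_comm, inv_eq_of_mul_eq_one_right]
      unfold lam; linear_combination s.2.2
    have e3 : lam ^ (2 * j + 1) = lam ^ (2 * j) * lam := zpow_add_one₀ hl.ne' _
    have e4 : emb (u * ⟨1, 1⟩) = lam ^ (2 * j + 1) := by rw [emb_mul, h1, e1, e3]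
    refine ⟨u * ⟨1, 1⟩, ?_, e4, ?_⟩
    · intro h; rw [h, emb_zero] at e4; exact absurd e4 (by positivity)
    · rw [embc_mul, h2, abs_mul, e2, abs_of_pos (by positivity), e3, mul_inv]

theorem exists_inner {a : Zsqrtd 2} (ha : a ≠ 0) (hN : a.norm.natAbs ≠ 1) :
    ∃ k : Zsqrtd 2, k ≠ 0 ∧ 0 < emb k / emb a ∧ emb k / emb a < 1 ∧ |embc k / embc a| < 1 := by
  have s := sqrt_two_bounds
  have b1 := emb_ne_zero ha
  have b2 := embc_ne_zero ha
  have hN0 := norm_ne_zero_of_ne ha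
  rcases Int.even_or_odd a.re with ⟨j, hj⟩ | hodd
  · have i1 : emb a = √2 * emb ⟨a.im, j⟩ := by
      simp only [emb, hj]; push_cast; linear_combination -(j : ℝ) * s.2.2
    have i2 : embc a = -√2 * embc ⟨a.im, j⟩ := by
      simp only [embc, hj]; push_cast; linear_combination -(j : ℝ) * s.2.2
    have j1 : emb ⟨a.im, j⟩ ≠ 0 := by intro h; apply b1; rw [i1, h, mul_zero]
    have j2 : embc ⟨a.im, j⟩ ≠ 0 := by intro h; apply b2; rw [i2, h, mul_zero]
    have q1 : emb ⟨a.im, j⟩ / emb a = 1 / √2 := by rw [i1]; field_simp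
    have q2 : |embc ⟨a.im, j⟩ / embc a| = 1 / √2 := by
      rw [i2, show embc ⟨a.im, j⟩ / (-√2 * embc ⟨a.im, j⟩) = -(1 / √2) by field_simp, abs_neg,
        abs_of_pos (by positivity)]
    have lt : 1 / √2 < 1 := by rw [div_lt_one (by linarith)]; linarith
    refine ⟨⟨a.im, j⟩, ?_, by rw [q1]; positivity, by rw [q1]; exact lt, by rw [q2]; exact lt⟩
    intro h; rw [h, emb_zero] at j1; exact j1 rfl
  · have h3 : 3 ≤ a.norm.natAbs := by
      have : Odd a.norm := by
        rw [Zsqrtd.norm_def]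
        exact (hodd.mul hodd).sub_even ⟨a.im * a.im, by ring⟩
      have := Int.natAbs_odd.2 this
      rcases this with ⟨r, hr⟩
      omega
    have h3' : (3 : ℝ) ≤ |emb a| * |embc a| := by
      rw [← abs_mul, emb_mul_embc, ← Int.cast_abs, Int.abs_eq_natAbs]; exact_mod_cast h3
    have l1 : (1 : ℝ) < lam := by unfold lam; linarith
    have l0 := lam_pos
    obtain ⟨n, n1, n2⟩ := exists_mem_Ioc_zpow (abs_pos.2 b1) l1
    obtain ⟨u, u0, u1, u2⟩ := exists_lam_zpow n
    have p0 : 0 < lam ^ n := by positivity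
    rw [zpow_add_one₀ l0.ne'] at n2
    have m : |embc u / embc a| < 1 := by
      have a2 := abs_pos.2 b2
      rw [abs_div, u2, div_lt_one a2, inv_lt_iff_one_lt_mul₀ p0]
      have l3 : lam < 3 := by unfold lam; linarith
      have := mul_pos p0 a2
      nlinarith
    rcases lt_or_gt_of_ne b1 with h | h
    · rw [abs_of_neg h] at n1
      refine ⟨-u, neg_ne_zero.2 u0, ?_, ?_, ?_⟩
      · rw [emb_neg, u1]; exact div_pos_of_neg_of_neg (by linarith) h
      · rw [emb_neg, u1, div_lt_one_of_neg h]; linarith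
      · rwa [embc_neg, neg_div, abs_neg]
    · rw [abs_of_pos h] at n1
      refine ⟨u, u0, ?_, ?_, m⟩
      · rw [u1]; positivity
      · rw [u1, div_lt_one h]; linarith

theorem Av.norm_eq_one {ε t x₁ x₂ : ℝ} {w p : ℝ × ℝ} (h : Av ε t x₁ w (p + x₂ • w))
    (hε : 0 < ε) (hε' : √ε ≤ 1 / 10 ^ 30) (ht : 0 ≤ t) (ht' : t < 1) (hw : w ∈ Woct)
    (hp : |p.1| ≤ 2 ∧ |p.2| ≤ 2)
    {a b c d : Zsqrtd 2} (ha : a ≠ 0) (hd : a * d - b * c = 1) {γ γ' : ℝ}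
    (hγ : emb a * x₁ + emb b = γ * (ε * emb a)) (hγ' : embc a * x₂ + embc b = γ' * embc a)
    (a1 : |ε * emb a| ≤ 36 * √ε) (a3 : |embc a| ≤ 108) 
    (hN : |emb a * embc a| < 12600) (g1 : |γ| < 12600) (g2 : |γ'| < 12600) :
    a.norm.natAbs = 1 := by
  by_contra H
  have b1 := emb_ne_zero ha
  have b2 := embc_ne_zero ha
  obtain ⟨k, k0, k1, k2, k3⟩ := exists_inner ha H
  set κ := emb k / emb a with hκ
  set κ' := embc k / embc a with hκ'
  have e1 : emb k = κ * emb a := by rw [hκ]; field_simp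
  have e2 : embc k = κ' * embc a := by rw [hκ']; field_simp
  have N0 : 0 < |emb a * embc a| := abs_pos.2 (mul_ne_zero b1 b2)
  have key : ∀ x y : ℝ, 0 ≤ |x * y| → 1 ≤ |x * emb a| * |y * embc a| →
      1 ≤ 12600 * (|x| * |y|) := fun x y h1 h2 => by
    rw [← abs_mul, show x * emb a * (y * embc a) = (x * y) * (emb a * embc a) by ring,
      abs_mul] at h2
    rw [← abs_mul]; nlinarith
  have f1 := key κ κ' (abs_nonneg _) (by rw [← e1, ← e2]; exact one_le_abs_norm k0)
  have f2 := key (1 - κ) (1 - κ') (abs_nonneg _) (by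
    rw [sub_mul, sub_mul, one_mul, one_mul, ← e1, ← e2, ← emb_sub, ← embc_sub]
    refine one_le_abs_norm (sub_ne_zero.2 ?_)
    rintro rfl; rw [hκ, div_self b1] at k2; exact lt_irrefl _ k2)
  have f3 := key (1 + κ) (1 + κ') (abs_nonneg _) (by
    rw [add_mul, add_mul, one_mul, one_mul, ← e1, ← e2, ← emb_add, ← embc_add]
    refine one_le_abs_norm fun h => ?_
    rw [eq_neg_of_add_eq_zero_right h, emb_neg, neg_div, div_self b1] at hκ
    linarith)
  have k3' := abs_lt.1 k3
  rw [abs_of_pos k1] at f1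
  rw [abs_of_pos (by linarith), abs_of_pos (by linarith)] at f2 f3
  have r1 : 1 / 25200 ≤ κ := by nlinarith [abs_nonneg κ']
  have r2 : 1 / 25200 ≤ 1 - κ := by nlinarith
  have r3 : |κ'| ≤ 1 - 1 / 25200 := by
    rw [abs_le]; constructor <;> nlinarith
  obtain ⟨μ, m1, m2⟩ := exists_small_multiplier (δ := ε * emb a) (δ' := embc a)
    (l := 1 / (2 * 10 ^ 10)) (l' := 1 / 10 ^ 10) (A := κ * emb c)
    (mul_ne_zero hε.ne' b1) b2 (by positivity) (by
      rw [abs_mul]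
      calc 14 * (|ε * emb a| * |embc a|) ≤ 14 * ((36 * √ε) * 108) := by gcongr
        _ ≤ _ := by linarith) (κ' * embc c) (1 / (2 * 10 ^ 10)) 0
  set z := ε * emb a * (emb μ + κ * emb c)
  set z' := embc a * (embc μ + κ' * embc c)
  rw [sub_zero] at m2
  refine h.basis ha hd hγ hγ' k μ (κ := κ) (κ' := κ') (z := z) (z' := z')
    e1.symm e2.symm rfl rfl ?_
  rw [abs_lt] at m1
  have z0 : 0 < z := by linarith
  have z1 : z ≤ 1 / 10 ^ 10 := by linarith
  have G1 : |γ * z| ≤ 1 / 10 ^ 5 := by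
    rw [abs_mul, abs_of_pos z0]
    calc |γ| * z ≤ 12600 * (1 / 10 ^ 10) := by gcongr
      _ ≤ _ := by norm_num
  have G2 : |γ' * z'| ≤ 1 / 10 ^ 5 / 2 := by
    rw [abs_mul]
    calc |γ'| * |z'| ≤ 12600 * (1 / 10 ^ 10) := by gcongr
      _ ≤ _ := by norm_num
  have hw2 := abs_lt_of_mem_Woct hw
  have Q := abs_combo_le ⟨hw2.1.le, hw2.2.le⟩ hp G2 m2.le
  rw [abs_le] at G1
  have X0 : 0 < κ + γ * z := by linarith
  refine ⟨X0, by linarith, ?_, ?_⟩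
  · have t0 := mul_nonneg ht X0.le
    have t1 := mul_le_of_le_one_left X0.le ht'.le
    rw [abs_lt]
    constructor <;> linarith
  · rw [add_smul, add_assoc]
    exact smul_add_mem_Woct hw r3 (Q.1.trans (by norm_num)) (Q.2.trans (by norm_num))

theorem Av.exists_near_of_nonneg {ε t x₁ x₂ : ℝ} {w p : ℝ × ℝ}
    (h : Av ε t x₁ w (p + x₂ • w)) (hε : 0 < ε) (hε' : √ε ≤ 1 / 10 ^ 30) (ht : 0 ≤ t)
    (ht' : t < 1) (hw : w ∈ Woct) (hp : |p.1| ≤ 2 ∧ |p.2| ≤ 2) :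
    ∃ α : Zsqrtd 2, |x₁ - emb α| ≤ 12600 * ε ∧ |x₂ - embc α| ≤ 12600 := by
  have hε1 : ε < 1 := by
    by_contra! h1
    have := Real.one_le_sqrt.2 h1
    linarith
  obtain ⟨a, b, c, d, ha, hd, a1, a2, a3, a4⟩ := exists_short_primitive hε hε1 x₁ x₂
  have b1 := emb_ne_zero ha
  have b2 := embc_ne_zero ha
  have hγ : emb a * x₁ + emb b = (emb a * x₁ + emb b) / (ε * emb a) * (ε * emb a) := by
    field_simp
  have hγ' : embc a * x₂ + embc b = (embc a * x₂ + embc b) / embc a * embc a := by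
    field_simp
  have hw2 := abs_lt_of_mem_Woct hw
  have B := h.norm_mul_lt hε (by linarith) (by rw [abs_of_nonneg ht]; exact ht'.le)
    ⟨hw2.1.le, hw2.2.le⟩ hp ha hd hγ hγ' a1 a2 a3 a4
  set γ := (emb a * x₁ + emb b) / (ε * emb a)
  set γ' := (embc a * x₂ + embc b) / embc a
  have o1 : 1 ≤ |emb a * embc a| := by rw [abs_mul]; exact one_le_abs_norm ha
  have o2 := abs_nonneg γ
  have o3 := abs_nonneg γ'
  have o4 : 1 ≤ (1 + |γ|) * (1 + |γ'|) := by nlinarith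
  have g0 : (1 + |γ|) * (1 + |γ'|) < 12600 := by nlinarith
  have g1 : |γ| < 12600 := by nlinarith
  have g2 : |γ'| < 12600 := by nlinarith
  have N := h.norm_eq_one hε hε' ht ht' hw hp ha hd hγ hγ' a1 a3 (by nlinarith) g1 g2
  obtain ⟨a', ha'⟩ : ∃ a', a * a' = 1 := by
    have : a * star a = a.norm := (Zsqrtd.norm_eq_mul_conj a).symm
    rcases Int.natAbs_eq a.norm with h | h <;> rw [N] at h <;> rw [h] at this
    · exact ⟨star a, by simpa using this⟩
    · exact ⟨-star a, by simpa using congrArg Neg.neg this⟩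
  have e1 := congrArg emb ha'
  have e2 := congrArg embc ha'
  rw [emb_mul, emb_one] at e1
  rw [embc_mul, embc_one] at e2
  refine ⟨-(b * a'), ?_, ?_⟩
  · rw [emb_neg, emb_mul, show x₁ - -(emb b * emb a') = ε * γ by
      linear_combination -x₁ * e1 + emb a' * hγ + γ * ε * e1, abs_mul, abs_of_pos hε, mul_comm]
    gcongr
  · rw [embc_neg, embc_mul, show x₂ - -(embc b * embc a') = γ' by
      linear_combination -x₂ * e2 + embc a' * hγ' + γ' * e2]
    exact g2.le

theorem Av.neg {ε t x : ℝ} {w p : ℝ × ℝ} (h : Av ε t x w p) : Av ε (-t) (-x) w (-p) := by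
  intro m n
  have := h (-m) n
  rw [emb_neg, embc_neg] at this
  rwa [show -emb m * x = emb m * -x by ring, ← abs_neg,
    show ∀ X, -(t * X - ε * -emb m) = -t * X - ε * emb m from fun X => by ring, neg_smul,
    ← smul_neg] at this

/-- Avoidance forces the parameters of the unipotent part to be close to a lattice point. -/
theorem Av.exists_near {ε t x₁ x₂ e : ℝ} {w : ℝ × ℝ} (h : Av ε t x₁ w (pvec e w x₂))
    (he : |e| = 1) (hε : 0 < ε) (hε' : √ε ≤ 1 / 10 ^ 30) (ht : |t| < 1) (hw : w ∈ Wp) :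
    ∃ α : Zsqrtd 2, |x₁ - emb α| ≤ 12600 * ε ∧ |x₂ - embc α| ≤ 12600 := by
  have hw' := (mem_Wp_iff.1 hw).1
  rcases le_total 0 t with h0 | h0
  · rw [pvec_eq] at h
    exact h.exists_near_of_nonneg hε hε' h0 (lt_of_abs_lt ht) hw' (abs_pvec_zero_le he hw)
  · have h' := h.neg
    rw [neg_pvec, pvec_eq] at h'
    obtain ⟨α, h1, h2⟩ := h'.exists_near_of_nonneg hε hε' (by linarith)
      (by linarith [(abs_lt.1 ht).1]) hw' (abs_pvec_zero_le (by rwa [abs_neg]) hw)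
    refine ⟨-α, ?_, ?_⟩
    · rw [← abs_neg, emb_neg]; convert h1 using 2; ring
    · rw [← abs_neg, embc_neg]; convert h2 using 2; ring

end LatticeWindow

section Rescaled

/-- Parameters `(τ, w, η, y)` in the rescaled avoidance problem. -/
def EE (e ε : ℝ) : Set (ℝ × (ℝ × ℝ) × (ℝ × ℝ)) :=
  {q | (0 < q.1 ∧ q.1 < 1 / ε) ∧ q.2.1 ∈ Wp ∧ |q.2.2.1| ≤ 12600 ∧ |q.2.2.2| ≤ 12600 ∧
    Av ε (1 - ε * q.1) (ε * q.2.2.1) q.2.1 (pvec e q.2.1 q.2.2.2)}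

/-- Some translate of `-c w` along `p` meets the octagon. -/
def Meets (c : ℝ) (w p : ℝ × ℝ) : Prop := ∃ v : ℝ, v • p - c • w ∈ Woct

/-- The limit of the sets `EE e ε` as `ε → 0`. -/
def Lim (e : ℝ) : Set (ℝ × (ℝ × ℝ) × (ℝ × ℝ)) :=
  {q | 0 < q.1 ∧ q.2.1 ∈ Wp ∧ (0 < q.2.2.1 ∧ q.2.2.1 ≤ 1 / 2) ∧ |q.2.2.2| ≤ 12600 ∧
    ¬Meets lam q.2.1 (pvec e q.2.1 q.2.2.2) ∧
    ∀ m : Zsqrtd 2, -q.1 < emb m → emb m < 0 →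
      q.2.1 + embc m • pvec e q.2.1 q.2.2.2 ∉ Woct}

/-- Both translates of `w` by `±δ p` leave the octagon. -/
def Exits (δ : ℝ) (w p : ℝ × ℝ) : Prop := w + δ • p ∉ Woct ∧ w - δ • p ∉ Woct

theorem Av.not_mem {ε τ η : ℝ} {w p : ℝ × ℝ} (h : Av ε (1 - ε * τ) (ε * η) w p) (hε : 0 < ε)
    {m n : Zsqrtd 2} {X : ℝ} (hX : emb n + ε * η * emb m = X) (h0 : 0 < X) (h1 : X < 1)
    (h2 : -(τ * X) < emb m) (h3 : ε * emb m < (2 - ε * τ) * X) :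
    embc n • w + embc m • p ∉ Woct := by
  intro hmem
  have e : emb m * (ε * η) + emb n = X := by rw [← hX]; ring
  refine h m n ⟨by rwa [e], by rwa [e], ?_, by rwa [add_comm]⟩
  rw [e, abs_lt]
  have := mul_lt_mul_of_pos_left h2 hε
  constructor <;> linarith

/-- If the octagon is avoided along all points of an interval, then it is short. -/
theorem exits_of_avoid {A L b : ℝ} {w p : ℝ × ℝ} (hL : 0 < L) (hw : w ∈ Woct)
    (h : ∀ m : Zsqrtd 2, A < emb m → emb m < A + L → w + (embc m - b) • p ∉ Woct) :
    Exits (84 / L) w p := by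
  have key : ∀ s : ℝ, |s| = 1 → w + (s * (84 / L)) • p ∉ Woct := fun s hs hmem => by
    obtain ⟨m, m1, m2⟩ := exists_mem_rect (l := L / 2) (l' := 28 / L) (by positivity)
      (by field_simp; norm_num) (A + L / 2) (b + s * (56 / L))
    rw [abs_lt] at m1
    refine h m (by linarith) (by linarith) ?_
    set d := embc m - b with hd
    have hs2 : s * s = 1 := by rw [← abs_mul_abs_self, hs, one_mul]
    have hL2 : 84 / L = 3 * (28 / L) := by ring
    have hL3 : 56 / L = 2 * (28 / L) := by ring
    have hp : 0 < 28 / L := by positivity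
    have m3 : |s * d - 56 / L| < 28 / L := by
      rw [show s * d - 56 / L = s * (embc m - (b + s * (56 / L))) by
        rw [hd]; linear_combination 56 / L * hs2, abs_mul, hs, one_mul]
      exact m2
    rw [abs_lt] at m3
    set r := s * d / (84 / L) with hr
    have hr' : r * (84 / L) = s * d := by rw [hr]; field_simp
    have r0 : 0 ≤ r := div_nonneg (by linarith) (by positivity)
    have r1 : r ≤ 1 := by rw [hr, div_le_one (by positivity)]; linarith
    have := convex_Woct hw hmem (by linarith : 0 ≤ 1 - r) r0 (by ring)
    have e : d = r * (s * (84 / L)) := by linear_combination -s * hr' - d * hs2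
    convert this using 1
    rw [e, smul_add, smul_smul, sub_smul, one_smul]; abel
  refine ⟨by simpa using key 1 (by simp), ?_⟩
  have := key (-1) (by simp)
  rwa [neg_one_mul, neg_smul, ← sub_eq_add_neg] at this

theorem abs_pvec_le {e : ℝ} (he : |e| = 1) {w : ℝ × ℝ} (hw : w ∈ Wp) {y : ℝ}
    (hy : |y| ≤ 12600) : |(pvec e w y).1| ≤ 30000 ∧ |(pvec e w y).2| ≤ 30000 := by
  have hw2 := abs_lt_of_mem_Woct (mem_Wp_iff.1 hw).1
  have := abs_combo_le ⟨hw2.1.le, hw2.2.le⟩ (abs_pvec_zero_le he hw) hy (abs_one.le)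
  rw [one_smul, add_comm, ← pvec_eq] at this
  exact ⟨this.1.trans (by norm_num), this.2.trans (by norm_num)⟩

section

variable {ε τ η : ℝ} {w p : ℝ × ℝ}

theorem Av.exits_of_neg (h : Av ε (1 - ε * τ) (ε * η) w p) (hε : 0 < ε) (hτ : 0 < τ)
    (hτ' : τ < 1 / ε) (hw : w ∈ Woct) (hη : |η| ≤ 12600) (h0 : η < 0) :
    Exits (84 * 10 ^ 5 * ε) w p := by
  have ht : ε * τ < 1 := by rwa [lt_div_iff₀' hε] at hτ'
  have := exits_of_avoid (A := 0) (L := 1 / 10 ^ 5 / ε) (b := 0) (p := p) (by positivity) hw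
    (fun m m1 m2 => by
      rw [zero_add, lt_div_iff₀' hε] at m2
      have m3 : 0 < ε * emb m := by positivity
      rw [abs_le] at hη
      have m4 : -(1 / 2) < ε * η * emb m := by nlinarith
      have m5 : ε * η * emb m < 0 := by nlinarith
      have := h.not_mem (m := m) (n := 1) hε rfl (by rw [emb_one]; linarith)
        (by rw [emb_one]; linarith) (by rw [emb_one]; nlinarith) (by rw [emb_one]; nlinarith)
      rwa [embc_one, one_smul, ← sub_zero (embc m)] at this)
  rwa [show 84 / (1 / 10 ^ 5 / ε) = 84 * 10 ^ 5 * ε by field_simp] at this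

theorem Av.exits_of_pos (h : Av ε (1 - ε * τ) (ε * η) w p) (hε : 0 < ε) (hτ : 0 < τ)
    (hτ' : τ < 1 / ε) (hw : w ∈ Woct) (hη : |η| ≤ 12600) (h0 : 0 < η) :
    Exits (84 * 10 ^ 5 / τ) w p := by
  have ht : ε * τ < 1 := by rwa [lt_div_iff₀' hε] at hτ'
  have := exits_of_avoid (A := -(1 / 10 ^ 5 * τ)) (L := 1 / 10 ^ 5 * τ) (b := 0) (p := p)
    (by positivity) hw
    (fun m m1 m2 => by
      rw [neg_add_cancel] at m2
      rw [abs_of_pos h0] at hη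
      have m3 : 0 < ε * η := by positivity
      have m4 : -(1 / 2) < ε * η * emb m := by
        have a1 : ε * η * -emb m ≤ ε * 12600 * (1 / 10 ^ 5 * τ) := by gcongr; linarith; linarith
        nlinarith
      have m5 : ε * η * emb m < 0 := by nlinarith
      have m6 : ε * emb m < 0 := by nlinarith
      have := h.not_mem (m := m) (n := 1) hε rfl (by rw [emb_one]; linarith)
        (by rw [emb_one]; linarith) (by rw [emb_one]; nlinarith) (by rw [emb_one]; nlinarith)
      rwa [embc_one, one_smul, ← sub_zero (embc m)] at this)
  rwa [show 84 / (1 / 10 ^ 5 * τ) = 84 * 10 ^ 5 / τ by field_simp] at this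

theorem Av.le_of_abs_le (h : Av ε (1 - ε * τ) (ε * η) w p) (hε : 0 < ε) (hε' : ε ≤ 1 / 10 ^ 12)
    (hτ : 0 < τ) (hτ' : τ < 1 / ε) (hη : |η| ≤ 12600) (hp : |p.1| ≤ 30000 ∧ |p.2| ≤ 30000) :
    η ≤ 1 / 2 + ε * τ / 2 := by
  have ht : ε * τ < 1 := by rwa [lt_div_iff₀' hε] at hτ'
  have ht0 : 0 < ε * τ := by positivity
  by_contra! H
  have h0 : 0 < η := by linarith
  have h1 : 1 < (2 - ε * τ) * η := by nlinarith
  have := exits_of_avoid (A := 0) (L := 1 / 10 ^ 5 / ε) (b := 0) (p := p) (by positivity)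
    zero_mem_Woct
    (fun m m1 m2 => by
      rw [zero_add, lt_div_iff₀' hε] at m2
      have m3 : 0 < ε * emb m := by positivity
      rw [abs_of_pos h0] at hη
      have m4 : ε * η * emb m < 1 := by nlinarith
      have m5 : 0 < ε * η * emb m := by positivity
      have := h.not_mem (m := m) (n := 0) hε rfl (by rw [emb_zero]; linarith)
        (by rw [emb_zero]; linarith) (by rw [emb_zero]; nlinarith) (by rw [emb_zero]; nlinarith)
      rwa [embc_zero, zero_smul, ← sub_zero (embc m)] at this)
  rw [show 84 / (1 / 10 ^ 5 / ε) = 84 * 10 ^ 5 * ε by field_simp] at this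
  refine this.1 (mem_Woct_of_le_one ?_ ?_) <;>
    simp only [zero_add, Prod.smul_fst, Prod.smul_snd, smul_eq_mul, abs_mul, abs_of_pos hε] <;>
    norm_num <;> nlinarith [abs_nonneg p.1, abs_nonneg p.2]

theorem Av.not_meets (h : Av ε (1 - ε * τ) (ε * η) w p) (hε : 0 < ε) (hε' : ε ≤ 1 / 10 ^ 12)
    (hτ : 0 < τ) (hτ' : τ < 1 / ε) (hη : |η| ≤ 12600) (h0 : 0 < η)
    (hp : |p.1| ≤ 30000 ∧ |p.2| ≤ 30000) : ¬Meets (lam * (1 + 10 ^ 12 * ε)) w p := by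
  rintro ⟨v, hv⟩
  have ht : ε * τ < 1 := by rwa [lt_div_iff₀' hε] at hτ'
  have s := sqrt_two_bounds
  set θ := 10 ^ 12 * ε with hθ
  have θ0 : 0 < θ := by positivity
  have θ1 : θ ≤ 1 := by linarith
  have hw0 : (v / (1 + θ)) • p - lam • w = (1 / (1 + θ)) • (v • p - (lam * (1 + θ)) • w) := by
    rw [smul_sub, smul_smul, smul_smul]
    congr 2 <;> field_simp
  have hr : |1 / (1 + θ)| ≤ 1 - θ / (1 + θ) := by
    rw [abs_of_pos (by positivity)]; apply le_of_eq; field_simp; ring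
  have hmem : (v / (1 + θ)) • p - lam • w ∈ Woct := by
    rw [hw0]; refine smul_mem_Woct hv (hr.trans ?_); have : 0 < θ / (1 + θ) := by positivity
    linarith
  have := exits_of_avoid (A := 0) (L := 1 / 10 ^ 5 / ε) (b := v / (1 + θ)) (p := p)
    (by positivity) hmem
    (fun m m1 m2 => by
      rw [zero_add, lt_div_iff₀' hε] at m2
      have m3 : 0 < ε * emb m := by positivity
      rw [abs_of_pos h0] at hη
      have m4 : ε * η * emb m < 1 / 2 := by nlinarith
      have m5 : 0 < ε * η * emb m := by positivity
      have n1 : emb ⟨-1, 1⟩ = √2 - 1 := by simp [emb]; ring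
      have n2 : embc ⟨-1, 1⟩ = -lam := by simp [embc, lam]; ring
      have := h.not_mem (m := m) (n := ⟨-1, 1⟩) hε rfl (by rw [n1]; linarith)
        (by rw [n1]; linarith) (by rw [n1]; nlinarith) (by rw [n1]; nlinarith)
      rw [n2] at this
      convert this using 2
      module)
  rw [show 84 / (1 / 10 ^ 5 / ε) = 84 * 10 ^ 5 * ε by field_simp, hw0] at this
  refine this.1 (smul_add_mem_Woct hv hr ?_ ?_) <;>
    simp only [Prod.smul_fst, Prod.smul_snd, smul_eq_mul, abs_mul, abs_of_pos hε] <;>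
    rw [le_div_iff₀ (by positivity)] <;> norm_num
  · calc 8400000 * ε * |p.1| * (1 + θ) ≤ 8400000 * ε * 30000 * 2 := by
          gcongr; exacts [hp.1, by linarith]
      _ ≤ θ := by rw [hθ]; linarith
  · calc 8400000 * ε * |p.2| * (1 + θ) ≤ 8400000 * ε * 30000 * 2 := by
          gcongr; exacts [hp.2, by linarith]
      _ ≤ θ := by rw [hθ]; linarith

theorem Av.not_mem_of_pos (h : Av ε (1 - ε * τ) (ε * η) w p) (hε : 0 < ε)
    (hτ : 0 < τ) (hτ' : τ < 1 / ε) (h0 : 0 < η) {T : ℝ} (hT : T * (1 + ε * τ * η) ≤ τ)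
    (m : Zsqrtd 2) (m1 : -T < emb m) (m2 : emb m < 0) : w + embc m • p ∉ Woct := by
  have ht : ε * τ < 1 := by rwa [lt_div_iff₀' hε] at hτ'
  have k : 0 < ε * τ * η := by positivity
  have k2 : -τ < emb m * (1 + ε * τ * η) := by nlinarith
  have k3 : ε * η * emb m < 0 := by nlinarith [mul_pos hε h0]
  have k4 : 0 < 1 + ε * η * emb m := by
    have : 0 < τ * (1 + ε * η * emb m) := by nlinarith
    exact pos_of_mul_pos_right this hτ.le
  have := h.not_mem (m := m) (n := 1) hε rfl (by rw [emb_one]; linarith)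
    (by rw [emb_one]; linarith) (by rw [emb_one]; linarith) (by rw [emb_one]; nlinarith)
  rwa [embc_one, one_smul] at this

end

theorem Meets.mono {c c' : ℝ} {w p : ℝ × ℝ} (h : Meets c w p) (hc : |c'| ≤ c) : Meets c' w p := by
  obtain ⟨v, hv⟩ := h
  rcases (abs_nonneg c').trans hc |>.eq_or_lt with h0 | h0
  · have h0' : c' = 0 := abs_nonpos_iff.1 (by linarith)
    exact ⟨0, by rw [h0', zero_smul, zero_smul, sub_zero]; exact zero_mem_Woct⟩
  · refine ⟨c' / c * v, ?_⟩
    have := smul_mem_Woct hv (c := c' / c) (by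
      rw [abs_div, abs_of_pos h0, div_le_one h0]; exact hc)
    rwa [smul_sub, smul_smul, smul_smul, div_mul_cancel₀ _ h0.ne'] at this

theorem eq_one_of_abs_lt {n : Zsqrtd 2} (h0 : 0 < emb n) (h1 : emb n < 5 / 4)
    (h2 : |embc n| < lam) : n = 1 := by
  obtain ⟨s1, s2, s3⟩ := sqrt_two_bounds
  obtain ⟨a, b⟩ := n
  rw [abs_lt] at h2
  simp only [emb, embc, lam] at h0 h1 h2
  have ha : (a : ℝ) < 2 := by linarith
  have ha' : (-2 : ℝ) < a := by linarith
  have hb : (b : ℝ) < 2 := by nlinarith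
  have hb' : (-1 : ℝ) < b := by nlinarith
  have ha : a < 2 := by exact_mod_cast ha
  have ha' : -2 < a := by exact_mod_cast ha'
  have hb : b < 2 := by exact_mod_cast hb
  have hb' : -1 < b := by exact_mod_cast hb'
  interval_cases a <;> interval_cases b <;> first | rfl | (exfalso; push_cast at h0 h1 h2; linarith)

theorem av_of_mem_Lim {e ε : ℝ} (hε : 0 < ε) {q : ℝ × (ℝ × ℝ) × (ℝ × ℝ)}
    (hq : q ∈ Lim e) (hτ : q.1 < 1 / (2 * ε)) : q ∈ EE e ε := by
  obtain ⟨τ, w, η, y⟩ := q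
  obtain ⟨h1, h2, ⟨h3, h4⟩, h5, h6, h7⟩ := hq
  simp only at h1 h2 h3 h4 h5 h6 h7 hτ
  set p := pvec e w y
  rw [lt_div_iff₀ (by positivity)] at hτ
  have ht : 0 < ε * τ := by positivity
  refine ⟨⟨h1, ?_⟩, h2, ?_, h5, ?_⟩
  · simp only; rw [lt_div_iff₀ hε]; linarith
  · simp only; rw [abs_of_pos h3]; linarith
  simp only
  rintro m n ⟨X0, X1, X2, hmem⟩
  set X := emb m * (ε * η) + emb n with hX
  rw [abs_lt] at X2
  have m1 : ε * emb m < (2 - ε * τ) * X := by linarith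
  have m2 : -(ε * τ * X) < ε * emb m := by linarith
  have tX : 0 < ε * τ * X := by positivity
  have n0 : 0 < emb n := by
    rcases le_total (emb m) 0 with h | h
    · have : emb m * (ε * η) ≤ 0 := mul_nonpos_of_nonpos_of_nonneg h (by positivity)
      linarith
    · have : emb m * (ε * η) ≤ emb m * (ε * (1 / 2)) := by gcongr
      nlinarith
  have n1 : emb n < 5 / 4 := by
    rcases le_total (emb m) 0 with h | h
    · have : -emb m * (ε * η) ≤ -emb m * (ε * (1 / 2)) := by gcongr; linarith
      nlinarith
    · have : 0 ≤ emb m * (ε * η) := by positivity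
      linarith
  have n2 : |embc n| < lam := by
    by_contra! h
    have l0 := lam_pos
    refine h6 (Meets.mono (c := |embc n|) ?_ (by rwa [abs_of_pos l0]))
    rcases le_total (embc n) 0 with hn | hn
    · refine ⟨embc m, ?_⟩
      rwa [abs_of_nonpos hn, neg_smul, sub_neg_eq_add]
    · refine ⟨-embc m, ?_⟩
      rw [abs_of_nonneg hn, neg_smul, ← neg_add']
      exact neg_mem_Woct hmem
  obtain rfl := eq_one_of_abs_lt n0 n1 n2
  rw [emb_one] at hX
  have m3 : emb m < 0 := by
    by_contra! h
    have : 0 ≤ emb m * (ε * η) := by positivity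
    linarith
  refine h7 m ?_ m3 ?_
  · have : ε * (τ * X) < ε * τ := by nlinarith
    have : -τ * ε < emb m * ε := by linarith
    exact lt_of_mul_lt_mul_right this hε.le
  · rwa [embc_one, one_smul, add_comm] at hmem

end Rescaled

section Vertices

/-- The support constants of the octagon: `a x + b y < edge a b` for `a, b ∈ {-1, 0, 1}`. -/
def edge (a b : ℤ) : ℝ := if a = 0 ∨ b = 0 then lam / √2 else lam

/-- The intersection point of two lines spanned by edges of the octagon (or `0` if parallel). -/
def vertex (k : (ℤ × ℤ) × (ℤ × ℤ)) : ℝ × ℝ :=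
  ((k.2.2 * edge k.1.1 k.1.2 - k.1.2 * edge k.2.1 k.2.2) / (k.1.1 * k.2.2 - k.1.2 * k.2.1),
    (k.1.1 * edge k.2.1 k.2.2 - k.2.1 * edge k.1.1 k.1.2) / (k.1.1 * k.2.2 - k.1.2 * k.2.1))

def dirs : Finset (ℤ × ℤ) := Finset.Icc (-1) 1 ×ˢ Finset.Icc (-1) 1

theorem one_le_edge (a b : ℤ) : 1 ≤ edge a b := by
  obtain ⟨s1, s2, s3⟩ := sqrt_two_bounds
  unfold edge lam
  split_ifs
  · rw [le_div_iff₀ (by linarith)]; linarith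
  · linarith

theorem mem_dirs {d : ℤ × ℤ} : d ∈ dirs ↔ (-1 ≤ d.1 ∧ d.1 ≤ 1) ∧ (-1 ≤ d.2 ∧ d.2 ≤ 1) := by
  simp [dirs]

theorem mem_Woct_iff_edge {w : ℝ × ℝ} :
    w ∈ Woct ↔ ∀ d ∈ dirs, d.1 * w.1 + d.2 * w.2 < edge d.1 d.2 := by
  have s0 : 0 < √2 := by positivity
  have l0 := lam_pos
  have l1 : 0 < lam / √2 := by positivity
  constructor
  · rintro ⟨h1, h2, h3⟩ ⟨a, b⟩ hd
    obtain ⟨⟨a0, a1⟩, b0, b1⟩ := mem_dirs.1 hd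
    simp only at a0 a1 b0 b1 ⊢
    rw [abs_lt] at h1 h2
    have e1 := le_abs_self w.1
    have e2 := neg_abs_le w.1
    have e3 := le_abs_self w.2
    have e4 := neg_abs_le w.2
    interval_cases a <;> interval_cases b <;> simp [edge] <;> linarith
  · intro h
    have key : ∀ a b : ℤ, (-1 ≤ a ∧ a ≤ 1) ∧ (-1 ≤ b ∧ b ≤ 1) → a * w.1 + b * w.2 < edge a b :=
      fun a b h' => h (a, b) (mem_dirs.2 h')
    have k1 := key 1 0 (by norm_num)
    have k2 := key (-1) 0 (by norm_num)
    have k3 := key 0 1 (by norm_num)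
    have k4 := key 0 (-1) (by norm_num)
    have k5 := key 1 1 (by norm_num)
    have k6 := key 1 (-1) (by norm_num)
    have k7 := key (-1) 1 (by norm_num)
    have k8 := key (-1) (-1) (by norm_num)
    simp [edge] at k1 k2 k3 k4 k5 k6 k7 k8
    refine ⟨abs_lt.2 ⟨by linarith, by linarith⟩, abs_lt.2 ⟨by linarith, by linarith⟩, ?_⟩
    rcases abs_cases w.1 with h | h <;> rcases abs_cases w.2 with h' | h' <;> linarith

/-- If translating `w` both ways leaves the octagon, then `w` is close to a vertex. -/
theorem Exits.near_vertex {δ : ℝ} {w p : ℝ × ℝ} (h : Exits δ w p) (hδ : 0 < δ) (hw : w ∈ Woct)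
    (hp : |p.1| ≤ 30000 ∧ |p.2| ≤ 30000) : ∃ k ∈ dirs ×ˢ dirs,
      |w.1 - (vertex k).1| ≤ 120000 * δ ∧ |w.2 - (vertex k).2| ≤ 120000 * δ := by
  obtain ⟨h1, h2⟩ := h
  have hW := abs_lt_of_mem_Woct hw
  rw [mem_Woct_iff_edge] at h1 h2 hw
  push Not at h1 h2
  obtain ⟨⟨a, b⟩, hi, h1⟩ := h1
  obtain ⟨⟨c, d⟩, hj, h2⟩ := h2
  refine ⟨((a, b), (c, d)), Finset.mem_product.2 ⟨hi, hj⟩, ?_⟩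
  have w1 := hw _ hi
  have w2 := hw _ hj
  rw [mem_dirs] at hi hj
  simp only [Prod.fst_add, Prod.snd_add, Prod.fst_sub, Prod.snd_sub, Prod.smul_fst, Prod.smul_snd,
    smul_eq_mul] at h1 h2 w1 w2 hi hj
  have hp' : ∀ u v : ℤ, (-1 ≤ u ∧ u ≤ 1) ∧ (-1 ≤ v ∧ v ≤ 1) → |u * p.1 + v * p.2| ≤ 60000 := by
    intro u v ⟨hu, hv⟩
    have hu : |(u : ℝ)| ≤ 1 := abs_le.2 ⟨by exact_mod_cast hu.1, by exact_mod_cast hu.2⟩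
    have hv : |(v : ℝ)| ≤ 1 := abs_le.2 ⟨by exact_mod_cast hv.1, by exact_mod_cast hv.2⟩
    calc _ ≤ |u * p.1| + |v * p.2| := abs_add_le _ _
      _ ≤ 1 * 30000 + 1 * 30000 := by
        rw [abs_mul, abs_mul]; gcongr; exacts [hp.1, hp.2]
      _ = _ := by norm_num
  have pi := abs_le.1 (hp' a b hi)
  have pj := abs_le.1 (hp' c d hj)
  set x := edge a b - (a * w.1 + b * w.2) with hx
  set y := edge c d - (c * w.1 + d * w.2) with hy
  have x0 : 0 < x := by linarith
  have y0 : 0 < y := by linarith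
  have x1 : x ≤ δ * (a * p.1 + b * p.2) := by linarith
  have y1 : y ≤ -(δ * (c * p.1 + d * p.2)) := by linarith
  have x2 : x ≤ 60000 * δ := by nlinarith
  have y2 : y ≤ 60000 * δ := by nlinarith
  simp only [vertex]
  by_cases hD : (a : ℝ) * d - b * c = 0
  · simp only [hD, div_zero, sub_zero]
    suffices 2 ≤ 120000 * δ from ⟨by linarith [hW.1], by linarith [hW.2]⟩
    have o1 := one_le_edge a b
    have o2 := one_le_edge c d
    have hD' : a * d - b * c = 0 := by exact_mod_cast hD
    by_cases hs : a + c = 0 ∧ b + d = 0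
    · obtain ⟨e1, e2⟩ := hs
      have e1 : (a : ℝ) + c = 0 := by exact_mod_cast e1
      have e2 : (b : ℝ) + d = 0 := by exact_mod_cast e2
      have : x + y = edge a b + edge c d := by
        rw [hx, hy]; linear_combination -w.1 * e1 - w.2 * e2
      linarith
    · exfalso
      have x3 : 0 < a * p.1 + b * p.2 := pos_of_mul_pos_right (by linarith) hδ.le
      have y3 : 0 < -(c * p.1 + d * p.2) := pos_of_mul_pos_right (a := δ) (by linarith) hδ.le
      obtain ⟨⟨a0, a1⟩, b0, b1⟩ := hi
      obtain ⟨⟨c0, c1⟩, d0, d1⟩ := hj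
      clear_value x y
      clear hp' hx hy w1 w2 h1 h2 hw x1 y1 pi pj hD o1 o2
      interval_cases a <;> interval_cases b <;> interval_cases c <;> interval_cases d <;>
        simp at hs hD' x3 y3 <;> linarith
  · have hD1 : 1 ≤ |(a : ℝ) * d - b * c| := by
      have : a * d - b * c ≠ 0 := by exact_mod_cast hD
      exact_mod_cast Int.one_le_abs this
    have key : ∀ u v : ℤ, (-1 ≤ u ∧ u ≤ 1) → (-1 ≤ v ∧ v ≤ 1) → ∀ z : ℝ,
        z * ((a : ℝ) * d - b * c) = u * x + v * y → |z| ≤ 120000 * δ := by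
      intro u v hu hv z hz
      have hu : |(u : ℝ)| ≤ 1 := abs_le.2 ⟨by exact_mod_cast hu.1, by exact_mod_cast hu.2⟩
      have hv : |(v : ℝ)| ≤ 1 := abs_le.2 ⟨by exact_mod_cast hv.1, by exact_mod_cast hv.2⟩
      calc |z| ≤ |z| * |(a : ℝ) * d - b * c| := le_mul_of_one_le_right (abs_nonneg _) hD1
        _ = |u * x + v * y| := by rw [← abs_mul, hz]
        _ ≤ |u * x| + |v * y| := abs_add_le _ _
        _ ≤ 1 * (60000 * δ) + 1 * (60000 * δ) := by
          rw [abs_mul, abs_mul, abs_of_pos x0, abs_of_pos y0]; gcongr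
        _ = _ := by ring
    constructor
    · refine key (-d) b (by omega) (by omega) _ ?_
      rw [sub_mul, div_mul_cancel₀ _ hD]; push_cast; rw [hx, hy]; ring
    · refine key c (-a) (by omega) (by omega) _ ?_
      rw [sub_mul, div_mul_cancel₀ _ hD]; push_cast; rw [hx, hy]; ring

/-- Parameters `(w, η, y)` with `w` close to a vertex of the octagon. -/
def nearVertex (r : ℝ) : Set ((ℝ × ℝ) × (ℝ × ℝ)) :=
  ⋃ k ∈ dirs ×ˢ dirs, (Icc ((vertex k).1 - r) ((vertex k).1 + r) ×ˢ
    Icc ((vertex k).2 - r) ((vertex k).2 + r)) ×ˢ (Icc (-12600) 12600 ×ˢ Icc (-12600) 12600)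

theorem volume_nearVertex_le {r : ℝ} (hr : 0 ≤ r) :
    volume (nearVertex r) ≤ ENNReal.ofReal (10 ^ 12 * r ^ 2) := by
  have hc : (dirs ×ˢ dirs).card = 81 := by decide
  refine (measure_biUnion_finset_le _ _).trans ?_
  have (k : (ℤ × ℤ) × (ℤ × ℤ)) : volume ((Icc ((vertex k).1 - r) ((vertex k).1 + r) ×ˢ
      Icc ((vertex k).2 - r) ((vertex k).2 + r)) ×ˢ
      (Icc (-12600 : ℝ) 12600 ×ˢ Icc (-12600 : ℝ) 12600)) =
      ENNReal.ofReal ((2 * r) * (2 * r) * (25200 * 25200)) := by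
    rw [Measure.volume_eq_prod, Measure.prod_prod, Measure.volume_eq_prod, Measure.prod_prod,
      Measure.prod_prod, Real.volume_Icc, Real.volume_Icc, Real.volume_Icc,
      show ∀ x : ℝ, x + r - (x - r) = 2 * r by intro x; ring,
      show ∀ x : ℝ, x + r - (x - r) = 2 * r by intro x; ring,
      show (12600 : ℝ) - -12600 = 25200 by norm_num, ← ENNReal.ofReal_mul (by positivity),
      ← ENNReal.ofReal_mul (by norm_num), ← ENNReal.ofReal_mul (by positivity)]
  rw [Finset.sum_congr rfl (fun k _ => this k), Finset.sum_const, hc, nsmul_eq_mul,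
    ← ENNReal.ofReal_natCast, ← ENNReal.ofReal_mul (by positivity)]
  refine ENNReal.ofReal_le_ofReal ?_
  push_cast
  nlinarith [sq_nonneg r]

theorem Exits.mem_nearVertex {e δ r η y : ℝ} {w : ℝ × ℝ} (h : Exits δ w (pvec e w y)) (hδ : 0 < δ)
    (he : |e| = 1) (hw : w ∈ Wp) (hη : |η| ≤ 12600) (hy : |y| ≤ 12600) (hr : 120000 * δ ≤ r) :
    (w, (η, y)) ∈ nearVertex r := by
  obtain ⟨k, hk, h1, h2⟩ := h.near_vertex hδ (mem_Wp_iff.1 hw).1 (abs_pvec_le he hw hy)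
  rw [abs_le] at h1 h2 hη hy
  refine mem_iUnion₂.2 ⟨k, hk, ⟨⟨?_, ?_⟩, ?_, ?_⟩, hη, hy⟩ <;> simp only <;> linarith

/-- Parameters with `τ > T` and `w` within `10¹² / τ` of a vertex. -/
def vertexTail (T : ℝ) : Set (ℝ × (ℝ × ℝ) × (ℝ × ℝ)) :=
  {q | T < q.1 ∧ q.2 ∈ nearVertex (11 * 10 ^ 11 / q.1)}

theorem measurableSet_vertexTail (T : ℝ) : MeasurableSet (vertexTail T) := by
  have : vertexTail T = {q | T < q.1} ∩ ⋃ k ∈ dirs ×ˢ dirs, {a |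
      (((vertex k).1 - 11 * 10 ^ 11 / a.1 ≤ a.2.1.1 ∧ a.2.1.1 ≤ (vertex k).1 + 11 * 10 ^ 11 / a.1) ∧
      (vertex k).2 - 11 * 10 ^ 11 / a.1 ≤ a.2.1.2 ∧ a.2.1.2 ≤ (vertex k).2 + 11 * 10 ^ 11 / a.1) ∧
      (-12600 ≤ a.2.2.1 ∧ a.2.2.1 ≤ 12600) ∧ -12600 ≤ a.2.2.2 ∧ a.2.2.2 ≤ 12600} := by
    ext q
    simp only [vertexTail, nearVertex, mem_iUnion, exists_prop, mem_prod, mem_Icc, mem_inter_iff,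
      mem_ofPred_eq]
  rw [this]
  have m : Measurable fun a : ℝ × (ℝ × ℝ) × (ℝ × ℝ) => 11 * 10 ^ 11 / a.1 :=
    measurable_const.div measurable_fst
  refine (measurableSet_lt measurable_const measurable_fst).inter
    (Finset.measurableSet_biUnion _ fun k _ => ?_)
  simp only [ofPred_and]
  refine MeasurableSet.inter (MeasurableSet.inter (MeasurableSet.inter ?_ ?_)
    (MeasurableSet.inter ?_ ?_)) (MeasurableSet.inter (MeasurableSet.inter ?_ ?_)
    (MeasurableSet.inter ?_ ?_)) <;> exact measurableSet_le (by fun_prop) (by fun_prop)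

theorem volume_vertexTail_le {T : ℝ} (hT : 0 < T) :
    volume (vertexTail T) ≤ ENNReal.ofReal (10 ^ 37 / T) := by
  rw [Measure.volume_eq_prod, Measure.prod_apply (measurableSet_vertexTail T)]
  calc _ ≤ ∫⁻ τ, (Ioi T).indicator (fun τ => ENNReal.ofReal (10 ^ 37 * τ ^ (-2 : ℝ))) τ := by
        refine lintegral_mono fun τ => ?_
        by_cases h : T < τ
        · have τ0 := hT.trans h
          rw [indicator_of_mem (by exact h)]
          refine (measure_mono (t := nearVertex (11 * 10 ^ 11 / τ)) fun z hz => hz.2).trans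
            ((volume_nearVertex_le (by positivity)).trans (ENNReal.ofReal_le_ofReal ?_))
          rw [Real.rpow_neg τ0.le, Real.rpow_two, div_pow, ← mul_div_assoc, div_eq_mul_inv]
          gcongr
          norm_num
        · rw [indicator_of_notMem (by exact h), nonpos_iff_eq_zero]
          convert measure_empty (μ := volume)
          ext z
          simp only [mem_preimage, vertexTail, mem_ofPred_eq, mem_empty_iff_false, iff_false]
          exact fun hz => h hz.1
    _ = ENNReal.ofReal (∫ τ in Ioi T, 10 ^ 37 * τ ^ (-2 : ℝ)) := by
        rw [lintegral_indicator measurableSet_Ioi, ofReal_integral_eq_lintegral_ofReal]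
        · exact (integrableOn_Ioi_rpow_of_lt (by norm_num) hT).const_mul _
        · refine (ae_restrict_iff' measurableSet_Ioi).2 (ae_of_all _ fun τ hτ => ?_)
          have := hT.trans hτ
          simp only [Pi.zero_apply]
          positivity
    _ = _ := by
        rw [integral_const_mul, integral_Ioi_rpow_of_lt (by norm_num) hT]
        congr 1
        rw [show (-2 : ℝ) + 1 = -1 by norm_num, Real.rpow_neg_one, neg_div_neg_eq, div_one,
          div_eq_mul_inv]

end Vertices

section Gap

theorem isAddHaarMeasure_prod {E F : Type*} [NormedAddCommGroup E] [NormedAddCommGroup F]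
    [MeasureSpace E] [MeasureSpace F] [BorelSpace E] [BorelSpace F]
    [SecondCountableTopology E] [SecondCountableTopology F] [LocallyCompactSpace E]
    [LocallyCompactSpace F]
    [(volume : Measure E).IsAddHaarMeasure] [(volume : Measure F).IsAddHaarMeasure] :
    (volume : Measure (E × F)).IsAddHaarMeasure := by
  rw [Measure.volume_eq_prod]; infer_instance

theorem volume_preimage_scale {ρ : ℝ} (hρ : ρ ≠ 0) (S : Set ((ℝ × ℝ) × (ℝ × ℝ))) :
    volume ((fun z : (ℝ × ℝ) × (ℝ × ℝ) => (ρ • z.1, (z.2.1, (ρ ^ 2)⁻¹ * z.2.2))) ⁻¹' S) =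
      volume S := by
  have : (volume : Measure (ℝ × ℝ)).IsAddHaarMeasure := isAddHaarMeasure_prod
  have : (volume : Measure ((ℝ × ℝ) × (ℝ × ℝ))).IsAddHaarMeasure := isAddHaarMeasure_prod
  let f : (ℝ × ℝ) × (ℝ × ℝ) →ₗ[ℝ] (ℝ × ℝ) × (ℝ × ℝ) :=
    (ρ • LinearMap.id).prodMap (LinearMap.id.prodMap ((ρ ^ 2)⁻¹ • LinearMap.id))
  have hdet : LinearMap.det f = 1 := by
    rw [LinearMap.det_prodMap, LinearMap.det_prodMap, LinearMap.det_smul, LinearMap.det_smul]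
    simp [hρ]
  have := Measure.addHaar_preimage_linearMap volume (f := f) (by rw [hdet]; exact one_ne_zero) S
  rw [hdet, inv_one, abs_one, ENNReal.ofReal_one, one_mul] at this
  exact this

theorem volume_preimage_scale_fst {a : ℝ} (ha : a ≠ 0) (S : Set (ℝ × (ℝ × ℝ) × (ℝ × ℝ))) :
    volume ((fun q : ℝ × (ℝ × ℝ) × (ℝ × ℝ) => (a * q.1, q.2)) ⁻¹' S) =
      ENNReal.ofReal |a⁻¹| * volume S := by
  have : (volume : Measure (ℝ × ℝ)).IsAddHaarMeasure := isAddHaarMeasure_prod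
  have : (volume : Measure ((ℝ × ℝ) × (ℝ × ℝ))).IsAddHaarMeasure := isAddHaarMeasure_prod
  have : (volume : Measure (ℝ × (ℝ × ℝ) × (ℝ × ℝ))).IsAddHaarMeasure := isAddHaarMeasure_prod
  let f : ℝ × (ℝ × ℝ) × (ℝ × ℝ) →ₗ[ℝ] ℝ × (ℝ × ℝ) × (ℝ × ℝ) :=
    (a • LinearMap.id).prodMap LinearMap.id
  have hdet : LinearMap.det f = a := by
    rw [LinearMap.det_prodMap, LinearMap.det_smul]
    simp
  have := Measure.addHaar_preimage_linearMap volume (f := f) (by rwa [hdet]) S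
  rw [hdet] at this
  exact this

/-- Parameters for which the octagon is met at height `lam` but not at height `lam * (1 + θ)`. -/
def gap (e θ : ℝ) : Set ((ℝ × ℝ) × (ℝ × ℝ)) :=
  {z | z.1 ∈ Wp ∧ |z.2.1| ≤ 12600 ∧ |z.2.2| ≤ 12600 ∧ Meets lam z.1 (pvec e z.1 z.2.2) ∧
    ¬Meets (lam * (1 + θ)) z.1 (pvec e z.1 z.2.2)}

theorem measurableSet_Wp : MeasurableSet Wp := by
  have : Wp = Woct ∩ {w | lam • w ∈ Woct}ᶜ := by
    ext w; simp [mem_Wp_iff]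
  rw [this]
  exact isOpen_Woct.measurableSet.inter
    (isOpen_Woct.preimage (continuous_const_smul lam)).measurableSet.compl

theorem isOpen_meets (c : ℝ) : IsOpen {z : (ℝ × ℝ) × (ℝ × ℝ) | Meets c z.1 z.2} := by
  have : {z : (ℝ × ℝ) × (ℝ × ℝ) | Meets c z.1 z.2} =
      ⋃ v : ℝ, (fun z : (ℝ × ℝ) × (ℝ × ℝ) => v • z.2 - c • z.1) ⁻¹' Woct := by
    ext z; simp [Meets]
  rw [this]
  exact isOpen_iUnion fun v => isOpen_Woct.preimage (by fun_prop)

theorem measurable_prodMk_pvec (e : ℝ) :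
    Measurable fun z : (ℝ × ℝ) × (ℝ × ℝ) => (z.1, pvec e z.1 z.2.2) := by
  unfold pvec
  fun_prop

theorem measurableSet_meets (e c : ℝ) :
    MeasurableSet {z : (ℝ × ℝ) × (ℝ × ℝ) | Meets c z.1 (pvec e z.1 z.2.2)} :=
  measurable_prodMk_pvec e (isOpen_meets c).measurableSet

theorem measurableSet_gap (e θ : ℝ) : MeasurableSet (gap e θ) := by
  unfold gap
  simp only [ofPred_and]
  refine (measurable_fst measurableSet_Wp).inter (.inter ?_ (.inter ?_
    ((measurableSet_meets e _).inter (measurableSet_meets e _).compl)))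
  · exact measurableSet_le (by fun_prop) (by fun_prop)
  · exact measurableSet_le (by fun_prop) (by fun_prop)

theorem meets_scale {e c ρ y : ℝ} {w : ℝ × ℝ} (hρ : 0 < ρ) :
    Meets c (ρ • w) (pvec e (ρ • w) ((ρ ^ 2)⁻¹ * y)) ↔ Meets (c * ρ) w (pvec e w y) := by
  have h : pvec e (ρ • w) ((ρ ^ 2)⁻¹ * y) = ρ⁻¹ • pvec e w y := by
    rcases eq_or_ne (w.1 ^ 2 + w.2 ^ 2) 0 with h0 | h0
    · have h1 : w.1 = 0 := by nlinarith [sq_nonneg w.1, sq_nonneg w.2]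
      have h2 : w.2 = 0 := by nlinarith [sq_nonneg w.1, sq_nonneg w.2]
      ext <;> simp [pvec, h1, h2]
    · have h1 : (ρ * w.1) ^ 2 + (ρ * w.2) ^ 2 ≠ 0 := by
        rw [mul_pow, mul_pow, ← mul_add]; positivity
      ext <;> simp only [pvec, Prod.smul_fst, Prod.smul_snd, Prod.fst_add, Prod.snd_add,
        smul_eq_mul] <;> field_simp
  rw [h]
  constructor
  · rintro ⟨v, hv⟩
    exact ⟨v * ρ⁻¹, by rwa [smul_smul, smul_smul] at hv⟩
  · rintro ⟨v, hv⟩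
    refine ⟨v * ρ, ?_⟩
    rwa [smul_smul, smul_smul, mul_inv_cancel_right₀ hρ.ne']

theorem volume_gap_le {e θ : ℝ} (hθ : 0 < θ) (hθ' : θ ≤ 1 / 4) :
    volume (gap e θ) ≤ ENNReal.ofReal (10 ^ 12 * θ) := by
  obtain ⟨n, hn⟩ : ∃ n : ℕ, 1 / (2 * θ) - 1 < n ∧ n ≤ 1 / (2 * θ) :=
    ⟨⌊1 / (2 * θ)⌋₊, by linarith [Nat.lt_floor_add_one (1 / (2 * θ))],
      Nat.floor_le (by positivity)⟩
  obtain ⟨hn1, hn2⟩ := hn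
  have l0 := lam_pos
  set ρ : ℕ → ℝ := fun j => (1 + θ) ^ j with hρ
  have ρ1 : ∀ j, 1 ≤ ρ j := fun j => one_le_pow₀ (by linarith)
  have ρ2 : ∀ j ≤ n, ρ j ≤ 2 := fun j hj => by
    calc (1 + θ) ^ j ≤ (1 + θ) ^ n := pow_le_pow_right₀ (by linarith) hj
      _ ≤ Real.exp θ ^ n := by gcongr; linarith [Real.add_one_le_exp θ]
      _ = Real.exp (n * θ) := by rw [← Real.exp_nat_mul]
      _ ≤ Real.exp (1 / 2) := by
        gcongr
        calc (n : ℝ) * θ ≤ 1 / (2 * θ) * θ := by gcongr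
          _ = 1 / 2 := by field_simp
      _ ≤ 2 := by
        have h : Real.exp (1 / 2) * Real.exp (1 / 2) = Real.exp 1 := by
          rw [← Real.exp_add]; norm_num
        nlinarith [Real.exp_one_lt_d9, Real.exp_pos (1 / 2)]
  set A : ℕ → Set ((ℝ × ℝ) × (ℝ × ℝ)) := fun j =>
    (fun z : (ℝ × ℝ) × (ℝ × ℝ) => (ρ j • z.1, (z.2.1, (ρ j ^ 2)⁻¹ * z.2.2))) ⁻¹' gap e θ with hA
  have ρ0 : ∀ j, 0 < ρ j := fun j => by linarith [ρ1 j]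
  have hAm : ∀ j, MeasurableSet (A j) := fun j => by
    refine Measurable.comp (g := id) measurable_id ?_ (measurableSet_gap e θ)
    fun_prop
  have hmem : ∀ j z, z ∈ A j → Meets (lam * ρ j) z.1 (pvec e z.1 z.2.2) ∧
      ¬Meets (lam * ρ (j + 1)) z.1 (pvec e z.1 z.2.2) := by
    rintro j z ⟨-, -, -, h1, h2⟩
    rw [meets_scale (ρ0 j)] at h1 h2
    refine ⟨h1, ?_⟩
    rwa [mul_assoc, mul_comm (1 + θ), ← pow_succ] at h2
  have hdisj : Pairwise (Function.onFun Disjoint A) := by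
    have key : ∀ i j, i < j → Disjoint (A i) (A j) := fun i j hij => by
      refine Set.disjoint_left.2 fun z hi hj => (hmem i z hi).2 ((hmem j z hj).1.mono ?_)
      rw [abs_of_pos (mul_pos l0 (ρ0 _))]
      gcongr
      exact pow_le_pow_right₀ (by linarith) hij
    intro i j hij
    rcases lt_or_gt_of_ne hij with h | h
    exacts [key i j h, (key j i h).symm]
  have hsub : ⋃ j ∈ Finset.range n, A j ⊆ (Icc (-2) 2 ×ˢ Icc (-2) 2) ×ˢ
      (Icc (-12600) 12600 ×ˢ Icc (-50400) 50400) := by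
    refine iUnion₂_subset fun j hj z hz => ?_
    obtain ⟨h1, h2, h3, -⟩ := hz
    have hW := abs_lt_of_mem_Woct (mem_Wp_iff.1 h1).1
    have r1 := ρ1 j
    have r2 := ρ2 j (Finset.mem_range.1 hj).le
    have r0 := ρ0 j
    simp only [Prod.smul_fst, Prod.smul_snd, smul_eq_mul, abs_mul, abs_of_pos r0] at hW h2 h3
    rw [abs_inv, abs_of_pos (by positivity : 0 < ρ j ^ 2), inv_mul_le_iff₀ (by positivity)] at h3
    have h4 : |z.2.2| ≤ 50400 := h3.trans (by nlinarith)
    have h5 : |z.1.1| ≤ 2 := by nlinarith [abs_nonneg z.1.1]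
    have h6 : |z.1.2| ≤ 2 := by nlinarith [abs_nonneg z.1.2]
    exact ⟨⟨abs_le.1 h5, abs_le.1 h6⟩, abs_le.1 h2, abs_le.1 h4⟩
  have hvol := measure_mono (μ := volume) hsub
  rw [measure_biUnion_finset (fun i _ j _ h => hdisj h) (fun j _ => hAm j),
    Finset.sum_congr rfl (fun j _ => volume_preimage_scale (ρ0 j).ne' _), Finset.sum_const,
    Finset.card_range, nsmul_eq_mul, Measure.volume_eq_prod, Measure.prod_prod,
    Measure.volume_eq_prod, Measure.prod_prod, Measure.prod_prod, Real.volume_Icc, Real.volume_Icc,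
    Real.volume_Icc, ← ENNReal.ofReal_mul (by norm_num), ← ENNReal.ofReal_mul (by norm_num),
    ← ENNReal.ofReal_mul (by norm_num), ← Measure.volume_eq_prod, ← Measure.volume_eq_prod] at hvol
  have n0 : 1 / (4 * θ) ≤ n := by
    have : 1 ≤ 1 / (4 * θ) := by rw [le_div_iff₀ (by positivity)]; linarith
    have : 1 / (2 * θ) = 1 / (4 * θ) + 1 / (4 * θ) := by field_simp; norm_num
    linarith
  have n1 : ENNReal.ofReal (1 / (4 * θ)) ≤ n := by
    rw [← ENNReal.ofReal_natCast]; exact ENNReal.ofReal_le_ofReal n0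
  calc volume (gap e θ) = ENNReal.ofReal (4 * θ) *
        (ENNReal.ofReal (1 / (4 * θ)) * volume (gap e θ)) := by
        rw [← mul_assoc, ← ENNReal.ofReal_mul (by positivity), mul_one_div_cancel (by positivity),
          ENNReal.ofReal_one, one_mul]
    _ ≤ ENNReal.ofReal (4 * θ) * ENNReal.ofReal ((2 - -2) * (2 - -2) *
          ((12600 - -12600) * (50400 - -50400))) :=
        mul_le_mul_right ((mul_le_mul_left n1 _).trans hvol) _
    _ ≤ _ := by
        rw [← ENNReal.ofReal_mul (by positivity)]
        exact ENNReal.ofReal_le_ofReal (by linarith)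

end Gap

section Limit

theorem volume_box (a b c d f g h i j k : ℝ) (hab : a ≤ b) (hcd : c ≤ d) (hfg : f ≤ g)
    (hhi : h ≤ i) :
    volume (Icc a b ×ˢ ((Icc c d ×ˢ Icc f g) ×ˢ (Icc h i ×ˢ Icc j k))) =
      ENNReal.ofReal ((b - a) * (((d - c) * (g - f)) * ((i - h) * (k - j)))) := by
  have h1 := sub_nonneg.2 hab
  have h2 := sub_nonneg.2 hcd
  have h3 := sub_nonneg.2 hfg
  have h4 := sub_nonneg.2 hhi
  rw [Measure.volume_eq_prod, Measure.prod_prod, Measure.volume_eq_prod, Measure.prod_prod,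
    Measure.volume_eq_prod, Measure.prod_prod, Measure.prod_prod, Real.volume_Icc, Real.volume_Icc,
    Real.volume_Icc, Real.volume_Icc, Real.volume_Icc, ENNReal.ofReal_mul h1,
    ENNReal.ofReal_mul (mul_nonneg h2 h3), ENNReal.ofReal_mul h2, ENNReal.ofReal_mul h4]

theorem Lim.mem_vertexTail {e T : ℝ} (he : |e| = 1) {q : ℝ × (ℝ × ℝ) × (ℝ × ℝ)} (hq : q ∈ Lim e)
    (hT : T < q.1) : q ∈ vertexTail T := by
  obtain ⟨τ, w, η, y⟩ := q
  obtain ⟨h1, h2, ⟨h3, h4⟩, h5, -, h7⟩ := hq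
  simp only at h1 h2 h3 h4 h5 h7 hT
  have h := exits_of_avoid (A := -τ) (L := τ) (b := 0) (p := pvec e w y) h1 (mem_Wp_iff.1 h2).1
    (fun m m1 m2 => by rw [sub_zero]; exact h7 m m1 (by simpa using m2))
  refine ⟨hT, h.mem_nearVertex (by positivity) he h2 (by rw [abs_of_pos h3]; linarith) h5 ?_⟩
  rw [← mul_div_assoc]
  exact div_le_div_of_nonneg_right (by norm_num) h1.le

theorem volume_Lim_lt_top {e : ℝ} (he : |e| = 1) : volume (Lim e) < ⊤ := by
  have hsub : Lim e ⊆ vertexTail 1 ∪ Icc 0 1 ×ˢ ((Icc (-2) 2 ×ˢ Icc (-2) 2) ×ˢ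
      (Icc (-12600) 12600 ×ˢ Icc (-12600) 12600)) := by
    intro q hq
    rcases lt_or_ge 1 q.1 with h | h
    · exact Or.inl (Lim.mem_vertexTail he hq h)
    · obtain ⟨h1, h2, ⟨h3, h4⟩, h5, -⟩ := hq
      have hW := abs_lt_of_mem_Woct (mem_Wp_iff.1 h2).1
      exact Or.inr ⟨⟨h1.le, h⟩, ⟨abs_le.1 hW.1.le, abs_le.1 hW.2.le⟩, ⟨by linarith, by linarith⟩,
        abs_le.1 h5⟩
  refine (measure_mono hsub).trans_lt ((measure_union_le _ _).trans_lt (ENNReal.add_lt_top.2 ⟨?_, ?_⟩))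
  · exact (volume_vertexTail_le one_pos).trans_lt ENNReal.ofReal_lt_top
  · rw [volume_box _ _ _ _ _ _ _ _ _ _ (by norm_num) (by norm_num) (by norm_num) (by norm_num)]
    exact ENNReal.ofReal_lt_top

theorem volume_Lim_pos {e : ℝ} (he : |e| = 1) : 0 < volume (Lim e) := by
  have hsub : Icc (1 / 100) (1 / 10) ×ˢ ((Icc 1.59 1.61 ×ˢ Icc (-0.01) 0.01) ×ˢ
      (Icc 0.1 0.5 ×ˢ Icc (-0.01) 0.01)) ⊆ Lim e := by
    rintro ⟨τ, ⟨w1, w2⟩, η, y⟩ ⟨⟨t0, t1⟩, ⟨⟨a0, a1⟩, b⟩, ⟨c0, c1⟩, d⟩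
    have b := abs_le.2 b
    have d := abs_le.2 d
    simp only at t0 t1 a0 a1 b c0 c1 d
    obtain ⟨s1, s2, s3⟩ := sqrt_two_bounds
    have s0 : 0 < √2 := by linarith
    have w0 : 0 < w1 := by linarith
    set D := w1 ^ 2 + w2 ^ 2 with hD
    have hb2 : w2 ^ 2 ≤ 0.0001 := by
      rw [← sq_abs]; nlinarith [abs_nonneg w2]
    have D0 : 2.5 ≤ D := by nlinarith [sq_nonneg w2]
    have D1 : D ≤ 2.6 := by nlinarith
    have p1 : |e / D * w2 + y * w1| ≤ 0.021 := by
      calc _ ≤ |e / D * w2| + |y * w1| := abs_add_le _ _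
        _ = 1 / D * |w2| + |y| * w1 := by
          rw [abs_mul, abs_mul, abs_div, he, abs_of_pos w0, abs_of_pos (by linarith : 0 < D)]
        _ ≤ 1 / 2.5 * 0.01 + 0.01 * 1.61 := by gcongr
        _ ≤ _ := by norm_num
    have p2 : 0.6 ≤ |e / D * -w1 + y * w2| := by
      have h1 : |y * w2| ≤ 0.0001 := by
        rw [abs_mul]
        calc |y| * |w2| ≤ 0.01 * 0.01 := by gcongr
          _ = _ := by norm_num
      have h2 : 0.61 ≤ |e / D * -w1| := by
        rw [abs_mul, abs_div, he, abs_neg, abs_of_pos w0, abs_of_pos (by linarith : 0 < D),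
          one_div_mul_eq_div, le_div_iff₀ (by linarith)]
        linarith
      have h3 := abs_sub_abs_le_abs_sub (e / D * -w1) (-(y * w2))
      rw [abs_neg, sub_neg_eq_add] at h3
      linarith
    have hq : lam / √2 ≤ 1.71 := by
      rw [div_le_iff₀ s0]; unfold lam; linarith
    have hq' : 1.7 ≤ lam / √2 := by
      rw [le_div_iff₀ s0]; unfold lam; linarith
    have l1 : 2.414 ≤ lam := by unfold lam; linarith
    have l2 : lam ≤ 2.415 := by unfold lam; linarith
    refine ⟨by linarith, mem_Wp_iff.2 ⟨⟨?_, ?_, ?_⟩, fun h => ?_⟩, ⟨by simp only; linarith,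
      by simp only; linarith⟩, by simp only; linarith, ?_, fun m m1 m2 h => ?_⟩
    · simp only; rw [abs_of_pos w0]; linarith
    · simp only; linarith
    · simp only; rw [abs_of_pos w0]; linarith
    · have := h.1
      simp only [Prod.smul_mk, smul_eq_mul] at this
      rw [abs_of_pos (by positivity)] at this
      have k3 : 2.414 * 1.59 ≤ lam * w1 := by gcongr
      linarith
    · rintro ⟨v, h1, h2, -⟩
      simp only [pvec, Prod.smul_mk, smul_eq_mul, Prod.fst_sub, Prod.snd_sub,
        Prod.mk_add_mk, ← hD] at h1 h2
      have k1 : |v| * 0.6 ≤ 1.74 := by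
        have h3 := abs_sub_abs_le_abs_sub (v * (e / D * -w1 + y * w2)) (lam * w2)
        have h4 : |lam * w2| ≤ 0.025 := by
          
          rw [abs_mul, abs_of_pos (by linarith)]
          calc lam * |w2| ≤ 2.415 * 0.01 := by gcongr
            _ ≤ _ := by norm_num
        have h5 : |v| * 0.6 ≤ |v * (e / D * -w1 + y * w2)| := by rw [abs_mul]; gcongr
        linarith
      have k2 : |v * (e / D * w2 + y * w1)| ≤ 0.07 := by
        rw [abs_mul]
        calc |v| * |e / D * w2 + y * w1| ≤ 2.9 * 0.021 := by gcongr; linarith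
          _ ≤ _ := by norm_num
      have k3 : 2.414 * 1.59 ≤ lam * w1 := by gcongr
      rw [abs_lt] at h1
      rw [abs_le] at k2
      linarith
    · simp only at m1 m2
      have hm : m ≠ 0 := by rintro rfl; rw [emb_zero] at m2; exact lt_irrefl _ m2
      have hN := one_le_abs_norm hm
      have h2 := h.2.1
      simp only [pvec, Prod.smul_mk, smul_eq_mul, Prod.mk_add_mk, ← hD] at h2
      have k1 : |emb m| ≤ 1 / 10 := by rw [abs_of_neg m2]; linarith
      have k2 : 10 ≤ |embc m| := by
        linarith [mul_le_mul_of_nonneg_right k1 (abs_nonneg (embc m))]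
      have k3 : 6 ≤ |embc m * (e / D * -w1 + y * w2)| := by
        rw [abs_mul]
        calc (6 : ℝ) = 10 * 0.6 := by norm_num
          _ ≤ _ := by gcongr
      have h3 := abs_sub_abs_le_abs_sub (embc m * (e / D * -w1 + y * w2)) (-w2)
      rw [abs_neg, sub_neg_eq_add, add_comm _ w2] at h3
      linarith
  refine lt_of_lt_of_le ?_ (measure_mono hsub)
  rw [volume_box _ _ _ _ _ _ _ _ _ _ (by norm_num) (by norm_num) (by norm_num) (by norm_num)]
  exact ENNReal.ofReal_pos.2 (by norm_num)

theorem volume_Lim_le {e ε : ℝ} (he : |e| = 1) (hε : 0 < ε) :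
    volume (Lim e) ≤ volume (EE e ε) + ENNReal.ofReal (10 ^ 38 * ε) := by
  have hsub : Lim e ⊆ EE e ε ∪ vertexTail (1 / (4 * ε)) := by
    intro q hq
    rcases lt_or_ge q.1 (1 / (2 * ε)) with h | h
    · exact Or.inl (av_of_mem_Lim hε hq h)
    · refine Or.inr (Lim.mem_vertexTail he hq (lt_of_lt_of_le ?_ h))
      gcongr; norm_num
  refine (measure_mono hsub).trans ((measure_union_le _ _).trans ?_)
  gcongr
  refine (volume_vertexTail_le (by positivity)).trans (ENNReal.ofReal_le_ofReal ?_)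
  rw [div_div_eq_mul_div, div_one]
  linarith

theorem volume_eta_zero : volume {q : ℝ × (ℝ × ℝ) × (ℝ × ℝ) | q.2.2.1 = 0} = 0 := by
  have : {q : ℝ × (ℝ × ℝ) × (ℝ × ℝ) | q.2.2.1 = 0} = univ ×ˢ (univ ×ˢ ({0} ×ˢ univ)) := by
    ext q; simp
  rw [this, Measure.volume_eq_prod, Measure.prod_prod, Measure.volume_eq_prod, Measure.prod_prod,
    Measure.volume_eq_prod ℝ ℝ, Measure.prod_prod {0}]
  simp

theorem EE_subset {e δ : ℝ} (he : |e| = 1) (hδ : 0 < δ) (hδ' : δ ≤ 1 / 10 ^ 3) :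
    EE e (δ ^ 4) ⊆ (fun q : ℝ × (ℝ × ℝ) × (ℝ × ℝ) => ((1 + δ ^ 2)⁻¹ * q.1, q.2)) ⁻¹' Lim e ∪
      (vertexTail (1 / δ) ∪ (Icc 0 (1 / δ ^ 4) ×ˢ nearVertex (11 * 10 ^ 11 * δ ^ 4) ∪
      ({q | q.2.2.1 = 0} ∪ (Icc 0 (1 / δ) ×ˢ ((Icc (-2) 2 ×ˢ Icc (-2) 2) ×ˢ
        (Icc (1 / 2) (1 / 2 + δ ^ 3 / 2) ×ˢ Icc (-12600) 12600)) ∪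
      Icc 0 (1 / δ) ×ˢ gap e (10 ^ 12 * δ ^ 4))))) := by
  rintro ⟨τ, w, η, y⟩ ⟨⟨h1, h2⟩, h3, h4, h5, h6⟩
  simp only at h1 h2 h3 h4 h5 h6
  have hε : 0 < δ ^ 4 := by positivity
  have hε' : δ ^ 4 ≤ 1 / 10 ^ 12 := by
    calc δ ^ 4 ≤ (1 / 10 ^ 3) ^ 4 := by gcongr
      _ = _ := by norm_num
  have hw := (mem_Wp_iff.1 h3).1
  have hW := abs_lt_of_mem_Woct hw
  have hp := abs_pvec_le he h3 h5
  rcases lt_trichotomy η 0 with h0 | h0 | h0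
  · refine Or.inr (Or.inr (Or.inl ⟨⟨h1.le, h2.le⟩, ?_⟩))
    exact (h6.exits_of_neg hε h1 h2 hw h4 h0).mem_nearVertex (by positivity) he h3 h4 h5
      (by linarith)
  · exact Or.inr (Or.inr (Or.inr (Or.inl h0)))
  rcases lt_or_ge (1 / δ) τ with hτ | hτ
  · refine Or.inr (Or.inl ⟨hτ, ?_⟩)
    refine (h6.exits_of_pos hε h1 h2 hw h4 h0).mem_nearVertex (by positivity) he h3 h4 h5 ?_
    rw [← mul_div_assoc]
    exact div_le_div_of_nonneg_right (by norm_num) h1.le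
  have hτ' : δ ^ 4 * τ ≤ δ ^ 3 := by
    calc δ ^ 4 * τ ≤ δ ^ 4 * (1 / δ) := by gcongr
      _ = δ ^ 3 := by field_simp
  rcases lt_or_ge (1 / 2) η with hη | hη
  · refine Or.inr (Or.inr (Or.inr (Or.inr (Or.inl ⟨⟨h1.le, hτ⟩,
      ⟨abs_le.1 hW.1.le, abs_le.1 hW.2.le⟩, ⟨hη.le, ?_⟩, abs_le.1 h5⟩))))
    have := h6.le_of_abs_le hε hε' h1 h2 h4 hp
    simp only; linarith
  by_cases hm : Meets lam w (pvec e w y)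
  · exact Or.inr (Or.inr (Or.inr (Or.inr (Or.inr ⟨⟨h1.le, hτ⟩, h3, h4, h5, hm,
      h6.not_meets hε hε' h1 h2 h4 h0 hp⟩))))
  · refine Or.inl ⟨?_, h3, ⟨h0, hη⟩, h5, hm, ?_⟩
    · simp only; positivity
    · refine h6.not_mem_of_pos hε h1 h2 h0 ?_
      rw [mul_comm, ← mul_assoc]
      simp only
      have k : δ ^ 4 * τ * η ≤ δ ^ 2 := by
        calc δ ^ 4 * τ * η ≤ δ ^ 3 * (1 / 2) := by gcongr
          _ ≤ δ ^ 2 := by nlinarith [pow_pos hδ 2]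
      calc (1 + δ ^ 4 * τ * η) * (1 + δ ^ 2)⁻¹ * τ ≤ (1 + δ ^ 2) * (1 + δ ^ 2)⁻¹ * τ := by gcongr
        _ = τ := by rw [mul_inv_cancel₀ (by positivity), one_mul]

theorem volume_EE_le {e δ : ℝ} (he : |e| = 1) (hδ : 0 < δ) (hδ' : δ ≤ 1 / 10 ^ 4) :
    volume (EE e (δ ^ 4)) ≤ ENNReal.ofReal (1 + δ ^ 2) * volume (Lim e) +
      ENNReal.ofReal (10 ^ 39 * δ) := by
  have d2 : δ ^ 2 ≤ δ := by nlinarith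
  have d3 : δ ^ 3 ≤ δ := by nlinarith [pow_pos hδ 2]
  have d4 : δ ^ 4 ≤ δ := by nlinarith [pow_pos hδ 3]
  refine (measure_mono (EE_subset he hδ (by linarith))).trans ?_
  refine (measure_union_le _ _).trans (add_le_add ?_ ?_)
  · rw [volume_preimage_scale_fst (by positivity), inv_inv, abs_of_pos (by positivity)]
  have e1 := volume_vertexTail_le (T := 1 / δ) (by positivity)
  have e2 : volume (Icc 0 (1 / δ ^ 4) ×ˢ nearVertex (11 * 10 ^ 11 * δ ^ 4)) ≤
      ENNReal.ofReal (10 ^ 37 * δ) := by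
    rw [Measure.volume_eq_prod, Measure.prod_prod, Real.volume_Icc]
    refine (mul_le_mul_right (volume_nearVertex_le (by positivity)) _).trans ?_
    rw [← ENNReal.ofReal_mul (by rw [sub_zero]; positivity)]
    refine ENNReal.ofReal_le_ofReal ?_
    have : (1 / δ ^ 4 - 0) * (10 ^ 12 * (11 * 10 ^ 11 * δ ^ 4) ^ 2) =
      10 ^ 12 * (11 * 10 ^ 11) ^ 2 * δ ^ 4 := by field_simp; ring
    rw [this]
    nlinarith
  have e3 : volume (Icc 0 (1 / δ) ×ˢ ((Icc (-2 : ℝ) 2 ×ˢ Icc (-2 : ℝ) 2) ×ˢ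
        (Icc (1 / 2) (1 / 2 + δ ^ 3 / 2) ×ˢ Icc (-12600 : ℝ) 12600))) ≤
      ENNReal.ofReal (10 ^ 37 * δ) := by
    rw [volume_box _ _ _ _ _ _ _ _ _ _ (by positivity) (by norm_num) (by norm_num)
      (by linarith [pow_pos hδ 3])]
    refine ENNReal.ofReal_le_ofReal ?_
    have : (1 / δ - 0) * ((2 - -2) * (2 - -2) * ((1 / 2 + δ ^ 3 / 2 - 1 / 2) *
      (12600 - -12600))) = 16 * 12600 * δ ^ 2 := by field_simp; ring
    rw [this]
    nlinarith
  have e4 : volume (Icc 0 (1 / δ) ×ˢ gap e (10 ^ 12 * δ ^ 4)) ≤ ENNReal.ofReal (10 ^ 37 * δ) := by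
    rw [Measure.volume_eq_prod, Measure.prod_prod, Real.volume_Icc]
    have hδ4 : δ ^ 4 ≤ (1 / 10 ^ 4) ^ 4 := by gcongr
    refine (mul_le_mul_right (volume_gap_le (by positivity) (by
      norm_num at hδ4; linarith)) _).trans ?_
    rw [← ENNReal.ofReal_mul (by rw [sub_zero]; positivity)]
    refine ENNReal.ofReal_le_ofReal ?_
    have : (1 / δ - 0) * (10 ^ 12 * (10 ^ 12 * δ ^ 4)) = 10 ^ 24 * δ ^ 3 := by
      rw [sub_zero]; field_simp
    rw [this]
    nlinarith
  rw [div_div_eq_mul_div, div_one] at e1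
  calc _ ≤ ENNReal.ofReal (10 ^ 37 * δ) + (ENNReal.ofReal (10 ^ 37 * δ) + (0 +
        (ENNReal.ofReal (10 ^ 37 * δ) + ENNReal.ofReal (10 ^ 37 * δ)))) := by
        refine (measure_union_le _ _).trans (add_le_add e1 ?_)
        refine (measure_union_le _ _).trans (add_le_add e2 ?_)
        refine (measure_union_le _ _).trans (add_le_add volume_eta_zero.le ?_)
        exact (measure_union_le _ _).trans (add_le_add e3 e4)
    _ ≤ _ := by
        have : 0 ≤ 10 ^ 37 * δ := by positivity
        rw [zero_add, ← ENNReal.ofReal_add this this, ← ENNReal.ofReal_add this (by positivity),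
          ← ENNReal.ofReal_add this (by positivity)]
        exact ENNReal.ofReal_le_ofReal (by linarith)

theorem abs_volume_sub_le {e ε : ℝ} (he : |e| = 1) (hε : 0 < ε) (hε' : ε ≤ 1 / 10 ^ 16) :
    |(volume (EE e ε)).toReal - (volume (Lim e)).toReal| ≤
      ((volume (Lim e)).toReal + 10 ^ 39) * ε ^ (1 / 4 : ℝ) := by
  obtain ⟨δ, hδ, rfl⟩ : ∃ δ : ℝ, 0 < δ ∧ δ ^ 4 = ε :=
    ⟨ε ^ (1 / 4 : ℝ), by positivity, by
      rw [← Real.rpow_natCast, ← Real.rpow_mul hε.le]; norm_num⟩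
  have hδ' : δ ≤ 1 / 10 ^ 4 := by
    refine le_of_pow_le_pow_left₀ (n := 4) (by norm_num) (by norm_num) (hε'.trans ?_)
    norm_num
  have hroot : (δ ^ 4) ^ (1 / 4 : ℝ) = δ := by
    rw [← Real.rpow_natCast, ← Real.rpow_mul hδ.le]; norm_num
  rw [hroot]
  have hL := (volume_Lim_lt_top he).ne
  have hu := volume_EE_le he hδ hδ'
  have hl := volume_Lim_le he hε
  have hE : volume (EE e (δ ^ 4)) ≠ ⊤ := by
    refine (hu.trans_lt (ENNReal.add_lt_top.2 ⟨?_, ENNReal.ofReal_lt_top⟩)).ne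
    exact ENNReal.mul_lt_top ENNReal.ofReal_lt_top hL.lt_top
  set V := (volume (EE e (δ ^ 4))).toReal with hV
  set M := (volume (Lim e)).toReal with hM
  have M0 : 0 ≤ M := ENNReal.toReal_nonneg
  have V0 : 0 ≤ V := ENNReal.toReal_nonneg
  rw [← ENNReal.ofReal_toReal hL, ← ENNReal.ofReal_toReal hE, ← hV, ← hM] at hu hl
  rw [← ENNReal.ofReal_mul (by positivity), ← ENNReal.ofReal_add (by positivity) (by positivity),
    ENNReal.ofReal_le_ofReal_iff (by positivity)] at hu
  rw [← ENNReal.ofReal_add (by positivity) (by positivity),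
    ENNReal.ofReal_le_ofReal_iff (by positivity)] at hl
  have d2 : δ ^ 2 ≤ δ := by nlinarith
  have d4 : δ ^ 4 ≤ δ := by nlinarith [pow_pos hδ 3, pow_pos hδ 2]
  rw [abs_le]
  constructor <;> nlinarith

end Limit

section Coordinates

theorem hz_eq {z : ℝ × ℝ} (hz0 : 0 < z.1 ^ 2 + z.2 ^ 2) (x : ℝ) :
    hz z x = !![z.2 / (z.1 ^ 2 + z.2 ^ 2) + x * z.1, -(z.1 / (z.1 ^ 2 + z.2 ^ 2)) + x * z.2;
      z.1, z.2] := by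
  have h0 := Real.sqrt_pos.2 hz0
  have h1 := Real.sq_sqrt hz0.le
  set R := √(z.1 ^ 2 + z.2 ^ 2) with hR
  rw [hz, ← hR, ← h1, nmat, amat, inv_inv]
  ext i j
  fin_cases i <;> fin_cases j <;> simp [Matrix.mul_apply, Fin.sum_univ_two] <;> field_simp

theorem latvec_vecMul_bd (β₁ β₂ : Zsqrtd 2) (a b c d a' b' c' d' : ℝ) :
    Matrix.vecMul (latvec β₁ β₂) (bd !![a, b; c, d] !![a', b'; c', d']) =
      ![emb β₁ * a + emb β₂ * c, emb β₁ * b + emb β₂ * d, embc β₁ * a' + embc β₂ * c',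
        embc β₁ * b' + embc β₂ * d'] := by
  ext i
  fin_cases i <;> simp [Matrix.vecMul, dotProduct, Fin.sum_univ_four, latvec, bd]

/-- In suitable coordinates, the emptiness condition in `Phi` does not involve `rr s`. -/
theorem inter_calTs_eq_empty_iff {s z₂ S u : ℝ} {w : ℝ × ℝ} (hS : 0 < S)
    (hs : S = √(s / thetaHat)) (hw : w ∈ Wp) (hu : u = lam ^ (2 * (2 * rr s))) (x₁ x₂ : ℝ) :
    latimage (hfull s z₂ w x₁ x₂) ∩ calTs s = ∅ ↔
      Av (1 / S ^ 2) (z₂ / S) (x₁ / u + 1 / S ^ 2 * (z₂ / S) / (1 + (z₂ / S) ^ 2)) w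
        (pvec 1 w (u * x₂)) := by
  obtain ⟨U, V, hUV, hU, hU', hV, hV'⟩ := exists_unit_zpow (2 * rr s)
  rw [← hu] at hU hU' hV hV'
  have l0 := lam_pos
  set l := lam ^ (2 * rr s) with hl
  have hl0 : 0 < l := by positivity
  have hl' : lam ^ (-(2 * rr s)) = l⁻¹ := by rw [_root_.zpow_neg]
  have hul : u = l ^ 2 := by rw [hu, hl, ← zpow_natCast, ← _root_.zpow_mul, mul_comm]; rfl
  have hw2 := half_le_of_mem_Wp hw
  have hw0 : 0 < w.1 ^ 2 + w.2 ^ 2 := by linarith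
  have hz1 : 0 < S ^ 2 + z₂ ^ 2 := by positivity
  have key : ∀ β₁ β₂ : Zsqrtd 2, Matrix.vecMul (latvec β₁ β₂) (hfull s z₂ w x₁ x₂) ∈ calTs s ↔
      (0 < emb (U * β₁) * (x₁ / u + 1 / S ^ 2 * (z₂ / S) / (1 + (z₂ / S) ^ 2)) + emb β₂ ∧
        emb (U * β₁) * (x₁ / u + 1 / S ^ 2 * (z₂ / S) / (1 + (z₂ / S) ^ 2)) + emb β₂ < 1 ∧
        |z₂ / S * (emb (U * β₁) * (x₁ / u + 1 / S ^ 2 * (z₂ / S) / (1 + (z₂ / S) ^ 2)) +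
          emb β₂) - 1 / S ^ 2 * emb (U * β₁)| <
          emb (U * β₁) * (x₁ / u + 1 / S ^ 2 * (z₂ / S) / (1 + (z₂ / S) ^ 2)) + emb β₂ ∧
        embc (U * β₁) • pvec 1 w (u * x₂) + embc β₂ • w ∈ Woct) := by
    intro β₁ β₂
    rw [hfull, hl', ← hl, ← hs, hz_eq, hz_eq, latvec_vecMul_bd, emb_mul, embc_mul, hU, hU']
    · set X := u * emb β₁ * (x₁ / u + 1 / S ^ 2 * (z₂ / S) / (1 + (z₂ / S) ^ 2)) + emb β₂ with hX
      simp only [calTs, calT, hl', ← hl, ← hs, Tset, mem_ofPred_eq, Prod.smul_mk, Prod.smul_fst,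
        Prod.smul_snd, smul_eq_mul, Matrix.cons_val]
      have e1 : l * (emb β₁ * (l⁻¹ * z₂ / ((l⁻¹ * S) ^ 2 + (l⁻¹ * z₂) ^ 2) + x₁ * (l⁻¹ * S)) +
          emb β₂ * (l⁻¹ * S)) = S * X := by
        rw [hX, hul]; field_simp; ring
      have e2 : l * (emb β₁ * (-(l⁻¹ * S / ((l⁻¹ * S) ^ 2 + (l⁻¹ * z₂) ^ 2)) + x₁ * (l⁻¹ * z₂)) +
          emb β₂ * (l⁻¹ * z₂)) = S * (z₂ / S * X - 1 / S ^ 2 * (u * emb β₁)) := by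
        rw [hX, hul]; field_simp; ring
      have e3 : (l⁻¹ * (embc β₁ * (l * w.2 / ((l * w.1) ^ 2 + (l * w.2) ^ 2) + x₂ * (l * w.1)) +
          embc β₂ * (l * w.1)), l⁻¹ * (embc β₁ * (-(l * w.1 / ((l * w.1) ^ 2 + (l * w.2) ^ 2)) +
          x₂ * (l * w.2)) + embc β₂ * (l * w.2))) =
          (u⁻¹ * embc β₁) • pvec 1 w (u * x₂) + embc β₂ • w := by
        rw [pvec, hul]
        ext <;> simp only [Prod.smul_fst, Prod.smul_snd, Prod.fst_add, Prod.snd_add, smul_eq_mul]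
          <;> field_simp
      rw [e1, e2, e3, abs_mul, abs_of_pos hS, mul_lt_mul_iff_right₀ hS,
        mul_lt_iff_lt_one_right hS, and_assoc, and_assoc]
      simp only [mul_pos_iff_of_pos_left hS]
    · simp only [smul_eq_mul, Prod.smul_fst, Prod.smul_snd]
      nlinarith [mul_pos (pow_pos hl0 2) hw0]
    · simp only [Prod.smul_mk, smul_eq_mul]
      positivity
  rw [Set.eq_empty_iff_forall_notMem]
  constructor
  · intro h m n hmn
    have hm : U * (V * m) = m := by rw [← mul_assoc, hUV, one_mul]
    refine h _ ⟨⟨_, ⟨V * m, n, rfl⟩, rfl⟩, (key _ _).2 ?_⟩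
    rw [hm]
    exact hmn
  · rintro h _ ⟨⟨_, ⟨β₁, β₂, rfl⟩, rfl⟩, hv⟩
    exact h _ _ ((key β₁ β₂).1 hv)

end Coordinates

section Periodic

theorem countable_zsqrtd : Countable (Zsqrtd 2) :=
  Function.Injective.countable (f := fun a : Zsqrtd 2 => (a.re, a.im)) fun a b h => by
    simp only [Prod.mk.injEq] at h
    exact Zsqrtd.ext h.1 h.2

theorem measurableSet_av {X : Type*} [MeasurableSpace X] (ε : ℝ) {t x : X → ℝ} {w p : X → ℝ × ℝ}
    (ht : Measurable t) (hx : Measurable x) (hw : Measurable w) (hp : Measurable p) :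
    MeasurableSet {a | Av ε (t a) (x a) (w a) (p a)} := by
  have := countable_zsqrtd
  have h : {a | Av ε (t a) (x a) (w a) (p a)} = ⋂ (m : Zsqrtd 2) (n : Zsqrtd 2),
      {a | 0 < emb m * x a + emb n ∧ emb m * x a + emb n < 1 ∧
        |t a * (emb m * x a + emb n) - ε * emb m| < emb m * x a + emb n ∧
        embc m • p a + embc n • w a ∈ Woct}ᶜ := by
    ext a
    simp only [Av, mem_iInter, mem_compl_iff, mem_ofPred_eq]
  rw [h]
  refine .iInter fun m => .iInter fun n => MeasurableSet.compl ?_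
  simp only [ofPred_and]
  refine (measurableSet_lt (by fun_prop) (by fun_prop)).inter
    ((measurableSet_lt (by fun_prop) (by fun_prop)).inter
    ((measurableSet_lt (by fun_prop) (by fun_prop)).inter ?_))
  have h : Measurable fun a => embc m • p a + embc n • w a := by fun_prop
  exact h isOpen_Woct.measurableSet

/-- The Minkowski embedding of `ℤ[√2]`. -/
def minkowski : Zsqrtd 2 →+ ℝ × ℝ where
  toFun a := (emb a, embc a)
  map_zero' := by rw [emb_zero, embc_zero]; rfl
  map_add' a b := by rw [emb_add, embc_add]; rfl

theorem mem_Fdom_iff {x : ℝ × ℝ} : x ∈ Fdom ↔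
    ((x.1 + x.2 - 3) / 2 ∈ Ico (0 : ℝ) 1 ∧ (x.1 - x.2 + 1) / (2 * √2) ∈ Ico (0 : ℝ) 1) := by
  have h2 : 0 < √2 := by positivity
  constructor
  · rintro ⟨r₁, h₁, r₂, h₂, rfl⟩
    constructor
    · convert h₁ using 1; ring
    · convert h₂ using 1; field_simp; ring
  · rintro ⟨h₁, h₂⟩
    refine ⟨_, h₁, _, h₂, ?_⟩
    ext <;> field_simp <;> ring

theorem measurableSet_Fdom : MeasurableSet Fdom := by
  have : Fdom = {x | (x.1 + x.2 - 3) / 2 ∈ Ico (0 : ℝ) 1} ∩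
      {x | (x.1 - x.2 + 1) / (2 * √2) ∈ Ico (0 : ℝ) 1} := by
    ext x; exact mem_Fdom_iff
  rw [this]
  have h1 : Measurable fun x : ℝ × ℝ => (x.1 + x.2 - 3) / 2 := by fun_prop
  have h2 : Measurable fun x : ℝ × ℝ => (x.1 - x.2 + 1) / (2 * √2) := by fun_prop
  exact (h1 measurableSet_Ico).inter (h2 measurableSet_Ico)

theorem existsUnique_vadd_mem_Fdom (x : ℝ × ℝ) : ∃! g : minkowski.range, g +ᵥ x ∈ Fdom := by
  have h2 : 0 < √2 := by positivity
  have key : ∀ a : Zsqrtd 2, (minkowski a + x ∈ Fdom ↔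
      a.re = -⌊(x.1 + x.2 - 3) / 2⌋ ∧ a.im = -⌊(x.1 - x.2 + 1) / (2 * √2)⌋) := by
    intro a
    rw [mem_Fdom_iff]
    have e1 : ((minkowski a + x).1 + (minkowski a + x).2 - 3) / 2 =
        (x.1 + x.2 - 3) / 2 + (a.re : ℝ) := by
      simp only [minkowski, AddMonoidHom.coe_mk, ZeroHom.coe_mk, Prod.fst_add, Prod.snd_add, emb,
        embc]
      ring
    have e2 : ((minkowski a + x).1 - (minkowski a + x).2 + 1) / (2 * √2) =
        (x.1 - x.2 + 1) / (2 * √2) + (a.im : ℝ) := by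
      simp only [minkowski, AddMonoidHom.coe_mk, ZeroHom.coe_mk, Prod.fst_add, Prod.snd_add, emb,
        embc]
      field_simp
      ring
    have fl : ∀ (y : ℝ) (k : ℤ), (y + k ∈ Ico (0 : ℝ) 1 ↔ k = -⌊y⌋) := fun y k => by
      rw [mem_Ico, ← Int.floor_eq_zero_iff.trans mem_Ico, Int.floor_add_intCast]
      omega
    rw [e1, e2, fl, fl]
  refine ⟨⟨minkowski ⟨_, _⟩, ⟨_, rfl⟩⟩, (key _).2 ⟨rfl, rfl⟩, ?_⟩
  rintro ⟨_, a, rfl⟩ h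
  obtain ⟨h1, h2⟩ := (key a).1 h
  exact Subtype.ext (congrArg minkowski (Zsqrtd.ext h1 h2))

theorem isAddFundamentalDomain_Fdom :
    IsAddFundamentalDomain minkowski.range Fdom (volume : Measure (ℝ × ℝ)) :=
  .mk' measurableSet_Fdom.nullMeasurableSet existsUnique_vadd_mem_Fdom

/-- A periodic set which is the disjoint union of translates of `N` has the volume of `N` modulo
the lattice. -/
theorem volume_inter_Fdom {P N : Set (ℝ × ℝ)} (hN : MeasurableSet N)
    (hP : ∀ x, x ∈ P ↔ ∃ a : Zsqrtd 2, minkowski a + x ∈ N)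
    (hd : ∀ (a : Zsqrtd 2) (x : ℝ × ℝ), x ∈ N → minkowski a + x ∈ N → a = 0) :
    volume (P ∩ Fdom) = volume N := by
  have := countable_zsqrtd
  have : Countable minkowski.range := (AddMonoidHom.rangeRestrict_surjective minkowski).countable
  have : (volume : Measure (ℝ × ℝ)).IsAddHaarMeasure := isAddHaarMeasure_prod
  have hU : P ∩ Fdom = ⋃ g : minkowski.range, (g +ᵥ N) ∩ Fdom := by
    ext x
    rw [← iUnion_inter, mem_inter_iff, mem_inter_iff, hP, mem_iUnion]
    refine and_congr_left fun _ => ?_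
    constructor
    · rintro ⟨a, ha⟩
      refine ⟨-⟨minkowski a, a, rfl⟩, ?_⟩
      rw [mem_vadd_set_iff_neg_vadd_mem, neg_neg]
      exact ha
    · rintro ⟨⟨_, a, rfl⟩, h⟩
      refine ⟨-a, ?_⟩
      rw [mem_vadd_set_iff_neg_vadd_mem] at h
      rw [map_neg]
      exact h
  rw [hU, measure_iUnion, isAddFundamentalDomain_Fdom.measure_eq_tsum]
  · intro g g' hgg
    refine Disjoint.mono inter_subset_left inter_subset_left (Set.disjoint_left.2 fun x h h' => ?_)
    obtain ⟨⟨_, a, rfl⟩, rfl⟩ : ∃ k : minkowski.range, k = g := ⟨g, rfl⟩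
    obtain ⟨⟨_, b, rfl⟩, rfl⟩ : ∃ k : minkowski.range, k = g' := ⟨g', rfl⟩
    rw [mem_vadd_set_iff_neg_vadd_mem] at h h'
    have h1 : -minkowski a + x ∈ N := h
    have h2 : -minkowski b + x ∈ N := h'
    have := hd (a - b) _ h1 (by convert h2 using 1; rw [map_sub]; abel)
    exact hgg (Subtype.ext (congrArg minkowski (sub_eq_zero.1 this)))
  · exact fun g => (hN.const_vadd g).inter measurableSet_Fdom

end Periodic

section Fibre

theorem Av.add {ε t x y e : ℝ} {w : ℝ × ℝ} (h : Av ε t x w (pvec e w y)) (a : Zsqrtd 2) :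
    Av ε t (x + emb a) w (pvec e w (y + embc a)) := by
  intro m n hmn
  have h1 : emb m * x + emb (n + m * a) = emb m * (x + emb a) + emb n := by
    rw [emb_add, emb_mul]; ring
  have h2 : embc m • pvec e w y + embc (n + m * a) • w =
      embc m • pvec e w (y + embc a) + embc n • w := by
    rw [embc_add, embc_mul, pvec, pvec]; module
  refine h m (n + m * a) ?_
  rw [h1, h2]
  exact hmn

/-- The rescaled fibre over `(t, w)`. -/
def fibre (ε t : ℝ) (w : ℝ × ℝ) : Set (ℝ × ℝ) :=
  {z | |z.1| ≤ 12600 ∧ |z.2| ≤ 12600 ∧ Av ε t (ε * z.1) w (pvec 1 w z.2)}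

theorem measurableSet_fibre (ε t : ℝ) (w : ℝ × ℝ) : MeasurableSet (fibre ε t w) := by
  simp only [fibre, ofPred_and]
  refine (measurableSet_le (by fun_prop) (by fun_prop)).inter
    ((measurableSet_le (by fun_prop) (by fun_prop)).inter
    (measurableSet_av ε (by fun_prop) (by fun_prop) (by fun_prop) ?_))
  unfold pvec
  fun_prop

theorem volume_preimage_affine {u c ε : ℝ} (hu : 0 < u) (hε : 0 < ε) (M : Set (ℝ × ℝ)) :
    volume ((fun x : ℝ × ℝ => ((x.1 / u + c) / ε, u * x.2)) ⁻¹' M) =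
      ENNReal.ofReal ε * volume M := by
  have : (volume : Measure (ℝ × ℝ)).IsAddHaarMeasure := isAddHaarMeasure_prod
  let f : ℝ × ℝ →ₗ[ℝ] ℝ × ℝ :=
    ((u * ε)⁻¹ • LinearMap.id).prodMap (u • LinearMap.id)
  have hdet : LinearMap.det f = ε⁻¹ := by
    rw [LinearMap.det_prodMap, LinearMap.det_smul, LinearMap.det_smul]
    simp only [Module.finrank_self, pow_one, LinearMap.det_id, mul_one]
    field_simp
  have h := Measure.addHaar_preimage_linearMap volume (f := f)
    (by rw [hdet]; exact inv_ne_zero hε.ne') M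
  rw [hdet, inv_inv, abs_of_pos hε] at h
  rw [← h, ← measure_preimage_add_right volume (u * c, 0) (f ⁻¹' M)]
  congr 1
  ext x
  simp only [mem_preimage]
  refine iff_of_eq (congrArg (· ∈ M) ?_)
  ext
  · change (x.1 / u + c) / ε = (u * ε)⁻¹ * (x.1 + u * c)
    field_simp
  · change u * x.2 = u * (x.2 + 0)
    ring

theorem volume_av_inter_Fdom {ε t u c : ℝ} {w : ℝ × ℝ} {k : ℤ} (hε : 0 < ε)
    (hε' : √ε ≤ 1 / 10 ^ 30) (ht : |t| < 1) (hw : w ∈ Wp) (hu : u = lam ^ (2 * k)) :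
    volume ({x : ℝ × ℝ | Av ε t (x.1 / u + c) w (pvec 1 w (u * x.2))} ∩ Fdom) =
      ENNReal.ofReal ε * volume (fibre ε t w) := by
  obtain ⟨U, V, hUV, -, -, hV, hV'⟩ := exists_unit_zpow k
  rw [← hu] at hV hV'
  have hu0 : 0 < u := hu ▸ zpow_pos lam_pos _
  have hε2 : ε ≤ 1 / 10 ^ 60 := by
    have := mul_self_le_mul_self (Real.sqrt_nonneg ε) hε'
    rw [Real.mul_self_sqrt hε.le] at this
    norm_num at this ⊢
    exact this
  rw [← volume_preimage_affine (c := c) hu0 hε]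
  have hshift : ∀ (a : Zsqrtd 2) (x : ℝ × ℝ), (minkowski a + x).1 / u + c =
      x.1 / u + c + emb (V * a) ∧ u * (minkowski a + x).2 = u * x.2 + embc (V * a) := by
    intro a x
    rw [emb_mul, embc_mul, hV, hV']
    constructor
    · change (emb a + x.1) / u + c = _
      ring
    · change u * (embc a + x.2) = _
      ring
  have hmem : ∀ x : ℝ × ℝ,
      x ∈ (fun x : ℝ × ℝ => ((x.1 / u + c) / ε, u * x.2)) ⁻¹' fibre ε t w ↔
        |x.1 / u + c| ≤ 12600 * ε ∧ |u * x.2| ≤ 12600 ∧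
          Av ε t (x.1 / u + c) w (pvec 1 w (u * x.2)) := by
    intro x
    simp only [mem_preimage, fibre, mem_ofPred_eq]
    rw [abs_div, abs_of_pos hε, div_le_iff₀ hε, mul_div_cancel₀ _ hε.ne']
  refine volume_inter_Fdom ?_ (fun x => ?_) fun a x hx hax => ?_
  · have : Measurable fun x : ℝ × ℝ => ((x.1 / u + c) / ε, u * x.2) := by fun_prop
    exact this (measurableSet_fibre ε t w)
  · simp only [hmem]
    constructor
    · intro hx
      obtain ⟨α, h1, h2⟩ := Av.exists_near hx (by simp) hε hε' ht hw
      have e : V * (U * -α) = -α := by rw [← mul_assoc, mul_comm V, hUV, one_mul]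
      refine ⟨U * -α, ?_⟩
      rw [(hshift _ _).1, (hshift _ _).2, e]
      refine ⟨by rwa [emb_neg, ← sub_eq_add_neg], by rwa [embc_neg, ← sub_eq_add_neg], ?_⟩
      exact Av.add hx _
    · rintro ⟨a, -, -, h⟩
      rw [(hshift _ _).1, (hshift _ _).2] at h
      have := Av.add h (-(V * a))
      rwa [emb_neg, embc_neg, add_neg_cancel_right, add_neg_cancel_right] at this
  · rw [hmem] at hx hax
    rw [(hshift _ _).1, (hshift _ _).2] at hax
    obtain ⟨h1, h2, -⟩ := hx
    obtain ⟨h3, h4, -⟩ := hax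
    have h5 : |emb (V * a)| ≤ 25200 * ε := by
      rw [abs_le] at *; constructor <;> linarith
    have h6 : |embc (V * a)| ≤ 25200 := by
      rw [abs_le] at *; constructor <;> linarith
    have h7 : V * a = 0 := by
      by_contra h
      have := one_le_abs_norm h
      have := mul_le_mul h5 h6 (abs_nonneg _) (by positivity)
      norm_num at hε2
      linarith
    rw [← one_mul a, ← hUV, mul_assoc, h7, mul_zero]

end Fibre

section Fubini

theorem setIntegral_measure_section {X Y : Type*} [MeasureSpace X] [MeasureSpace Y]
    [SFinite (volume : Measure Y)] {A : Set (X × Y)} {s : Set X} (hA : MeasurableSet A)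
    (hfin : volume A ≠ ⊤) (hs : ∀ x ∉ s, Prod.mk x ⁻¹' A = ∅) :
    ∫ x in s, (volume (Prod.mk x ⁻¹' A)).toReal = (volume A).toReal := by
  rw [setIntegral_eq_integral_of_forall_compl_eq_zero fun x hx => by
    rw [hs x hx, measure_empty, ENNReal.toReal_zero]]
  have hm := measurable_measure_prodMk_left (ν := volume) hA
  rw [Measure.volume_eq_prod, Measure.prod_apply hA] at hfin ⊢
  exact integral_toReal hm.aemeasurable (ae_lt_top hm hfin)

/-- Parameters `(z₂, w, η, y)` for which the lattice avoids the target, in rescaled coordinates. -/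
def Full (ε S : ℝ) : Set (ℝ × (ℝ × ℝ) × (ℝ × ℝ)) :=
  {q | (-S < q.1 ∧ q.1 < S) ∧ q.2.1 ∈ Wp ∧ q.2.2 ∈ fibre ε (q.1 / S) q.2.1}

theorem measurableSet_Full (ε S : ℝ) : MeasurableSet (Full ε S) := by
  simp only [Full, fibre, ofPred_and]
  refine ((measurableSet_lt (by fun_prop) (by fun_prop)).inter
    (measurableSet_lt (by fun_prop) (by fun_prop))).inter (.inter ?_ (.inter
    (measurableSet_le (by fun_prop) (by fun_prop)) (.inter
    (measurableSet_le (by fun_prop) (by fun_prop))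
    (measurableSet_av ε (by fun_prop) (by fun_prop) (by fun_prop) ?_))))
  · have : Measurable fun q : ℝ × (ℝ × ℝ) × (ℝ × ℝ) => q.2.1 := by fun_prop
    exact this measurableSet_Wp
  · unfold pvec
    fun_prop

theorem isBounded_Wp_prod : Bornology.IsBounded
    {p : (ℝ × ℝ) × (ℝ × ℝ) | p.1 ∈ Wp ∧ |p.2.1| ≤ 12600 ∧ |p.2.2| ≤ 12600} := by
  refine (Metric.isBounded_closedBall (x := 0) (r := 12600)).subset fun p hp => ?_
  obtain ⟨h1, h2, h3⟩ := hp
  obtain ⟨h4, h5⟩ := abs_lt_of_mem_Woct (mem_Wp_iff.1 h1).1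
  rw [mem_closedBall_zero_iff, Prod.norm_def, Prod.norm_def, Prod.norm_def]
  simp only [Real.norm_eq_abs]
  refine max_le (max_le ?_ ?_) (max_le h2 h3) <;> linarith

theorem volume_section_lt_top (ε t : ℝ) :
    volume {p : (ℝ × ℝ) × (ℝ × ℝ) | p.1 ∈ Wp ∧ p.2 ∈ fibre ε t p.1} < ⊤ := by
  have : (volume : Measure (ℝ × ℝ)).IsAddHaarMeasure := isAddHaarMeasure_prod
  have : (volume : Measure ((ℝ × ℝ) × (ℝ × ℝ))).IsAddHaarMeasure := isAddHaarMeasure_prod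
  exact (isBounded_Wp_prod.subset fun p hp => ⟨hp.1, hp.2.1, hp.2.2.1⟩).measure_lt_top

theorem volume_Full_lt_top (ε S : ℝ) : volume (Full ε S) < ⊤ := by
  have : (volume : Measure (ℝ × ℝ)).IsAddHaarMeasure := isAddHaarMeasure_prod
  have : (volume : Measure ((ℝ × ℝ) × (ℝ × ℝ))).IsAddHaarMeasure := isAddHaarMeasure_prod
  have : (volume : Measure (ℝ × (ℝ × ℝ) × (ℝ × ℝ))).IsAddHaarMeasure := isAddHaarMeasure_prod
  exact (((Metric.isBounded_Ioo (-S) S).prod isBounded_Wp_prod).subset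
    fun p hp => ⟨hp.1, hp.2.1, hp.2.2.1, hp.2.2.2.1⟩).measure_lt_top

theorem integral_ind_eq {s S z₂ : ℝ} {w : ℝ × ℝ} (hS : 0 < S) (hs : S = √(s / thetaHat))
    (hS' : 10 ^ 30 ≤ S) (hz : z₂ ∈ Ioo (-S) S) (hw : w ∈ Wp) :
    ∫ x in Fdom, ind (latimage (hfull s z₂ w x.1 x.2) ∩ calTs s = ∅) =
      1 / S ^ 2 * (volume (fibre (1 / S ^ 2) (z₂ / S) w)).toReal := by
  set ε := 1 / S ^ 2 with hε
  have hε0 : 0 < ε := by positivity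
  have hε1 : √ε ≤ 1 / 10 ^ 30 := by
    rw [hε, Real.sqrt_div zero_le_one, Real.sqrt_one, Real.sqrt_sq hS.le]
    exact one_div_le_one_div_of_le (by positivity) hS'
  have ht : |z₂ / S| < 1 := by
    rw [abs_div, abs_of_pos hS, div_lt_one hS, abs_lt]
    exact hz
  set u := lam ^ (2 * (2 * rr s)) with hu
  set c := 1 / S ^ 2 * (z₂ / S) / (1 + (z₂ / S) ^ 2)
  set A := {x : ℝ × ℝ | Av ε (z₂ / S) (x.1 / u + c) w (pvec 1 w (u * x.2))} with hA
  have hAm : MeasurableSet A := by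
    refine measurableSet_av ε (by fun_prop) (by fun_prop) (by fun_prop) ?_
    unfold pvec
    fun_prop
  have e : (fun x : ℝ × ℝ => ind (latimage (hfull s z₂ w x.1 x.2) ∩ calTs s = ∅)) =
      A.indicator 1 := by
    classical
    ext x
    rw [ind, indicator_apply]
    exact if_congr (inter_calTs_eq_empty_iff hS hs hw hu x.1 x.2) rfl rfl
  rw [e, integral_indicator_one hAm, measureReal_def, Measure.restrict_apply hAm,
    volume_av_inter_Fdom hε0 hε1 ht hw hu, ENNReal.toReal_mul, ENNReal.toReal_ofReal hε0.le]

theorem triple_integral_eq {s S : ℝ} (hS : 0 < S) (hs : S = √(s / thetaHat))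
    (hS' : 10 ^ 30 ≤ S) :
    ∫ z₂ in Ioo (-S) S, ∫ w in Wp, ∫ x in Fdom,
      ind (latimage (hfull s z₂ w x.1 x.2) ∩ calTs s = ∅) =
      1 / S ^ 2 * (volume (Full (1 / S ^ 2) S)).toReal := by
  have h1 : ∀ z₂ ∈ Ioo (-S) S, ∫ w in Wp, ∫ x in Fdom,
      ind (latimage (hfull s z₂ w x.1 x.2) ∩ calTs s = ∅) =
      1 / S ^ 2 * (volume (Prod.mk z₂ ⁻¹' Full (1 / S ^ 2) S)).toReal := by
    intro z₂ hz
    have hsec : Prod.mk z₂ ⁻¹' Full (1 / S ^ 2) S =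
        {p | p.1 ∈ Wp ∧ p.2 ∈ fibre (1 / S ^ 2) (z₂ / S) p.1} := by
      ext p
      exact and_iff_right hz
    have hm : MeasurableSet (Prod.mk z₂ ⁻¹' Full (1 / S ^ 2) S) :=
      measurable_prodMk_left (measurableSet_Full _ _)
    have hfin : volume (Prod.mk z₂ ⁻¹' Full (1 / S ^ 2) S) ≠ ⊤ := by
      rw [hsec]
      exact (volume_section_lt_top _ _).ne
    rw [setIntegral_congr_fun measurableSet_Wp fun w hw => integral_ind_eq hS hs hS' hz hw,
      integral_const_mul, ← setIntegral_measure_section (s := Wp) hm hfin]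
    · congr 1
      refine setIntegral_congr_fun measurableSet_Wp fun w hw => ?_
      simp only [hsec]
      congr 2
      ext p
      exact (and_iff_right hw).symm
    · intro w hw
      rw [hsec]
      exact eq_empty_of_forall_notMem fun p hp => hw hp.1
  rw [setIntegral_congr_fun measurableSet_Ioo h1, integral_const_mul,
    setIntegral_measure_section (measurableSet_Full _ _) (volume_Full_lt_top _ _).ne]
  exact fun z hz => eq_empty_of_forall_notMem fun p hp => hz hp.1

end Fubini

section Halves

theorem volume_preimage_reflect {e ε S : ℝ} (he : e = 1 ∨ e = -1) (hε : 0 < ε) (hS : 0 < S)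
    (M : Set (ℝ × (ℝ × ℝ) × (ℝ × ℝ))) :
    volume ((fun q : ℝ × (ℝ × ℝ) × (ℝ × ℝ) => ((1 - e * q.1 / S) / ε, (q.2.1, e • q.2.2))) ⁻¹' M) =
      ENNReal.ofReal (S * ε) * volume M := by
  have : (volume : Measure (ℝ × ℝ)).IsAddHaarMeasure := isAddHaarMeasure_prod
  have : (volume : Measure ((ℝ × ℝ) × (ℝ × ℝ))).IsAddHaarMeasure := isAddHaarMeasure_prod
  have : (volume : Measure (ℝ × (ℝ × ℝ) × (ℝ × ℝ))).IsAddHaarMeasure := isAddHaarMeasure_prod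
  have he2 : e ^ 2 = 1 := by rcases he with rfl | rfl <;> norm_num
  have he1 : |e| = 1 := by rcases he with rfl | rfl <;> norm_num
  have he0 : e ≠ 0 := by rintro rfl; norm_num at he2
  let f : ℝ × (ℝ × ℝ) × (ℝ × ℝ) →ₗ[ℝ] ℝ × (ℝ × ℝ) × (ℝ × ℝ) :=
    ((-e / (S * ε)) • LinearMap.id).prodMap (LinearMap.id.prodMap (e • LinearMap.id))
  have hdet : LinearMap.det f = -e / (S * ε) := by
    rw [LinearMap.det_prodMap, LinearMap.det_prodMap, LinearMap.det_smul, LinearMap.det_smul]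
    simp [he2]
  have h := Measure.addHaar_preimage_linearMap volume (f := f)
    (by rw [hdet]; exact div_ne_zero (neg_ne_zero.2 he0) (by positivity))
    ((fun q => q + (1 / ε, 0)) ⁻¹' M)
  rw [hdet, measure_preimage_add_right, inv_div, abs_div, abs_neg, he1, div_one,
    abs_of_pos (by positivity)] at h
  rw [← h]
  congr 1
  ext q
  refine iff_of_eq (congrArg (· ∈ M) ?_)
  change _ = (-e / (S * ε) * q.1 + 1 / ε, (q.2.1, e • q.2.2) + 0)
  rw [add_zero]
  refine Prod.ext ?_ rfl
  change (1 - e * q.1 / S) / ε = -e / (S * ε) * q.1 + 1 / ε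
  field_simp
  ring

theorem half_Full_eq {e ε S : ℝ} (he : e = 1 ∨ e = -1) (hε : 0 < ε) (hS : 0 < S) :
    Full ε S ∩ {q | 0 < e * q.1} =
      (fun q : ℝ × (ℝ × ℝ) × (ℝ × ℝ) => ((1 - e * q.1 / S) / ε, (q.2.1, e • q.2.2))) ⁻¹'
        EE e ε := by
  ext ⟨z, w, η, y⟩
  have he1 : |e| = 1 := by rcases he with rfl | rfl <;> norm_num
  have h1 : (0 < (1 - e * z / S) / ε ∧ (1 - e * z / S) / ε < 1 / ε) ↔ e * z < S ∧ 0 < e * z := by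
    rw [div_pos_iff_of_pos_right hε, div_lt_div_iff_of_pos_right hε, sub_pos, div_lt_one hS,
      sub_lt_self_iff, div_pos_iff_of_pos_right hS]
  have h2 : 1 - ε * ((1 - e * z / S) / ε) = e * (z / S) := by field_simp; ring
  have h3 : Av ε (e * (z / S)) (ε * (e * η)) w (pvec e w (e * y)) ↔
      Av ε (z / S) (ε * η) w (pvec 1 w y) := by
    rcases he with rfl | rfl
    · simp only [one_mul]
    · constructor <;> intro h
      · have := h.neg
        rw [neg_pvec] at this
        convert this using 1
        · ring
        · ring
        · congr 1 <;> ring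
      · have := h.neg
        rw [neg_pvec] at this
        convert this using 1
        · ring
        · ring
        · congr 1; ring
  have h4 : ((-S < z ∧ z < S) ∧ 0 < e * z) ↔ e * z < S ∧ 0 < e * z := by
    rcases he with rfl | rfl <;> constructor <;> rintro ⟨_, _⟩ <;> grind
  simp only [Full, fibre, EE, mem_inter_iff, mem_preimage, mem_ofPred_eq, Prod.smul_mk,
    smul_eq_mul, h1, h2, h3, ← h4, abs_mul, he1, one_mul]
  tauto

theorem volume_Full_eq {ε S : ℝ} (hε : 0 < ε) (hS : 0 < S) :
    volume (Full ε S) =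
      ENNReal.ofReal (S * ε) * (volume (EE 1 ε) + volume (EE (-1) ε)) := by
  have h0 : volume {q : ℝ × (ℝ × ℝ) × (ℝ × ℝ) | q.1 = 0} = 0 := by
    have : {q : ℝ × (ℝ × ℝ) × (ℝ × ℝ) | q.1 = 0} = {0} ×ˢ univ := by ext q; simp
    rw [this, Measure.volume_eq_prod, Measure.prod_prod]
    simp
  have hsplit : (Full ε S ∩ {q | 0 < 1 * q.1} ∪ Full ε S ∩ {q | 0 < -1 * q.1} : Set _)
      =ᵐ[volume] Full ε S := by
    rw [← inter_union_distrib_left]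
    refine inter_ae_eq_left_of_ae_eq_univ (Filter.eventuallyEq_univ.2 ?_)
    refine Filter.mem_of_superset (measure_eq_zero_iff_ae_notMem.1 h0) fun q hq => ?_
    rcases lt_or_gt_of_ne hq with h | h
    · exact Or.inr (by simpa using h)
    · exact Or.inl (by simpa using h)
  have hm : MeasurableSet (Full ε S ∩ {q | 0 < -1 * q.1}) :=
    (measurableSet_Full _ _).inter (measurableSet_lt (by fun_prop) (by fun_prop))
  rw [← measure_congr hsplit, measure_union _ hm, half_Full_eq (.inl rfl) hε hS,
    half_Full_eq (.inr rfl) hε hS, volume_preimage_reflect (.inl rfl) hε hS,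
    volume_preimage_reflect (.inr rfl) hε hS, mul_add]
  refine Set.disjoint_left.2 fun q h h' => ?_
  have h1 : 0 < 1 * q.1 := h.2
  have h2 : 0 < -1 * q.1 := h'.2
  linarith

end Halves

section Asymptotics

theorem thetaHat_pos : 0 < thetaHat := by unfold thetaHat; positivity

theorem Phi_eq {s S : ℝ} (hs0 : 0 < s) (hs : S = √(s / thetaHat)) (hS' : 10 ^ 30 ≤ S) :
    Phi s = thetaHat / ((2 : ℝ) ^ ((11 : ℝ) / 2) * zetaK2) *
      ((volume (EE 1 (1 / S ^ 2))).toReal + (volume (EE (-1) (1 / S ^ 2))).toReal) *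
        s ^ (-2 : ℝ) := by
  have hS : 0 < S := lt_of_lt_of_le (by positivity) hS'
  have hθ := thetaHat_pos
  have hS2 : 0 < 1 / S ^ 2 := by positivity
  have hζ : 0 < zetaK2 := by unfold zetaK2; positivity
  have hfin : volume (EE 1 (1 / S ^ 2)) ≠ ⊤ ∧ volume (EE (-1) (1 / S ^ 2)) ≠ ⊤ := by
    have h := (volume_Full_lt_top (1 / S ^ 2) S).ne
    rw [volume_Full_eq hS2 hS] at h
    rw [← ENNReal.add_ne_top]
    exact fun htop => h (by rw [htop, ENNReal.mul_top]; simpa using mul_pos hS hS2)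
  rw [Phi, ← hs, triple_integral_eq hS hs hS', volume_Full_eq hS2 hS, ENNReal.toReal_mul,
    ENNReal.toReal_ofReal (by positivity), ENNReal.toReal_add hfin.1 hfin.2]
  set V := (volume (EE 1 (1 / S ^ 2))).toReal + (volume (EE (-1) (1 / S ^ 2))).toReal
  set K := (2 : ℝ) ^ ((11 : ℝ) / 2)
  have hK : 0 < K := by positivity
  have hsS : √s = √thetaHat * S := by
    rw [hs, ← Real.sqrt_mul hθ.le, mul_div_cancel₀ _ hθ.ne']
  have hs2 : s = thetaHat * S ^ 2 := by
    rw [hs, Real.sq_sqrt (by positivity), mul_div_cancel₀ _ hθ.ne']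
  have hsq := Real.sq_sqrt hθ.le
  have hp : s ^ (-2 : ℝ) = (s ^ 2)⁻¹ := by
    rw [Real.rpow_neg hs0.le]
    norm_cast
  have hq : √thetaHat ≠ 0 := (Real.sqrt_pos.2 hθ).ne'
  rw [hp, hsS, hs2]
  generalize √thetaHat = q at *
  rw [← hsq]
  field_simp

end Asymptotics

theorem stmt19 : ∃ C > (0:ℝ), ∃ C' > (0:ℝ), ∃ s₀ > (0:ℝ), ∀ s ≥ s₀,
    |Phi s - C * s ^ (-(2:ℝ))| ≤ C' * s ^ (-(17:ℝ)/8) := by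
  have hθ := thetaHat_pos
  have hζ : 0 < zetaK2 := by unfold zetaK2; positivity
  have he : |(-1 : ℝ)| = 1 := by norm_num
  set L₁ := (volume (Lim 1)).toReal with hL₁
  set L₂ := (volume (Lim (-1))).toReal with hL₂
  have hp₁ : 0 < L₁ := ENNReal.toReal_pos (volume_Lim_pos abs_one).ne'
    (volume_Lim_lt_top abs_one).ne
  have hp₂ : 0 < L₂ := ENNReal.toReal_pos (volume_Lim_pos he).ne' (volume_Lim_lt_top he).ne
  set A := thetaHat / ((2 : ℝ) ^ ((11 : ℝ) / 2) * zetaK2) with hA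
  have hA0 : 0 < A := by positivity
  refine ⟨A * (L₁ + L₂), by positivity,
    A * (L₁ + L₂ + 2 * 10 ^ 39) * thetaHat ^ (1 / 4 : ℝ), by positivity,
    1 + thetaHat * 10 ^ 60, by positivity, fun s hs => ?_⟩
  have hs1 : 1 ≤ s := by linarith [show 0 < thetaHat * 10 ^ 60 by positivity]
  have hs0 : 0 < s := by linarith
  obtain ⟨S, hS⟩ : ∃ S, S = √(s / thetaHat) := ⟨_, rfl⟩
  have hS' : 10 ^ 30 ≤ S := by
    rw [hS]
    refine Real.le_sqrt_of_sq_le ?_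
    rw [le_div_iff₀ hθ]
    linarith
  have hε : 1 / S ^ 2 = thetaHat / s := by
    rw [hS, Real.sq_sqrt (by positivity), one_div_div]
  have hε0 : 0 < thetaHat / s := by positivity
  have hε1 : thetaHat / s ≤ 1 / 10 ^ 16 := by
    rw [div_le_div_iff₀ hs0 (by positivity)]
    linarith
  have h₁ := abs_volume_sub_le abs_one hε0 hε1
  have h₂ := abs_volume_sub_le he hε0 hε1
  rw [Phi_eq hs0 hS hS', hε, ← hA, ← sub_mul, ← mul_sub, abs_mul, abs_mul, abs_of_pos hA0,
    abs_of_pos (Real.rpow_pos_of_pos hs0 _)]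
  rw [← hL₁] at h₁
  rw [← hL₂] at h₂
  set V₁ := (volume (EE 1 (thetaHat / s))).toReal
  set V₂ := (volume (EE (-1) (thetaHat / s))).toReal
  have h₃ : |V₁ + V₂ - (L₁ + L₂)| ≤ (L₁ + L₂ + 2 * 10 ^ 39) * (thetaHat / s) ^ (1 / 4 : ℝ) := by
    rw [add_sub_add_comm]
    exact (abs_add_le _ _).trans ((add_le_add h₁ h₂).trans_eq (by ring))
  have h₄ : (thetaHat / s) ^ (1 / 4 : ℝ) ≤ thetaHat ^ (1 / 4 : ℝ) * s ^ (-1 / 8 : ℝ) := by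
    rw [div_eq_mul_inv, Real.mul_rpow hθ.le (by positivity), Real.inv_rpow hs0.le,
      ← Real.rpow_neg hs0.le]
    gcongr
    norm_num
  calc A * |V₁ + V₂ - (L₁ + L₂)| * s ^ (-2 : ℝ)
      ≤ A * ((L₁ + L₂ + 2 * 10 ^ 39) * (thetaHat ^ (1 / 4 : ℝ) * s ^ (-1 / 8 : ℝ))) *
        s ^ (-2 : ℝ) := by
        gcongr
        exact h₃.trans (by gcongr)
    _ = A * (L₁ + L₂ + 2 * 10 ^ 39) * thetaHat ^ (1 / 4 : ℝ) *
        (s ^ (-1 / 8 : ℝ) * s ^ (-2 : ℝ)) := by ring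
    _ = _ := by rw [← Real.rpow_add hs0]; norm_num

end
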